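/- arXiv:1607.01141 — 5 statements merged into one kernel-verified Lean document; each statement's English description precedes it below -/
import Mathlib

section
/- There are infinitely many primes p such that the projective norm graph P(p,4) contains a copy of the complete bipartite graph K_{4,6}; that is, there exist disjoint sets A, B of vertices of P(p,4) with |A| = 4 and |B| = 6 such that every vertex of A is adjacent to every vertex of B. -/
open Polynomial

/-- The projective norm graph on vertex set `L × Kˣ`, where `L/K` is a field extension:
two distinct vertices `(α, a)` and `(β, b)` are adjacent iff `N_{L/K}(α + β) = a * b`. -/
noncomputable def projNormGraph (K L : Type) [Field K] [Field L] [Algebra K L] :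
    SimpleGraph (L × Kˣ) :=
  SimpleGraph.fromRel fun v w => Algebra.norm K (v.1 + w.1) = (v.2 : K) * (w.2 : K)

/-- `G` contains a copy of the complete bipartite graph `K_{s,m}`. -/
def ContainsKst {V : Type} (G : SimpleGraph V) (s m : ℕ) : Prop :=
  ∃ A B : Finset V, Disjoint A B ∧ A.card = s ∧ B.card = m ∧
    ∀ a ∈ A, ∀ b ∈ B, G.Adj a b

/-- If `9 ∣ #L - 1`, every third root of unity of the finite field `L` is a cube. -/
theorem exists_cube_eq_of_cube_eq_one {L : Type*} [Field L] [Finite L]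
    (h9 : 9 ∣ Nat.card L - 1) {x : L} (hx : x ^ 3 = 1) : ∃ t : L, t ^ 3 = x := by
  have hx0 : x ≠ 0 := by
    rintro rfl
    simp at hx
  obtain ⟨g, hg⟩ := IsCyclic.exists_ofOrder_eq_natCard (α := Lˣ)
  have hmem : Units.mk0 x hx0 ∈ Submonoid.powers g := by
    have hz : Units.mk0 x hx0 ∈ Subgroup.zpowers g := by
      rw [Subgroup.eq_top_of_card_eq (Subgroup.zpowers g) (by rw [Nat.card_zpowers, hg])]
      trivial
    exact mem_powers_iff_mem_zpowers.2 hz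
  obtain ⟨k, hk⟩ := hmem
  have hk' : g ^ k = Units.mk0 x hx0 := hk
  have h3 : g ^ (k * 3) = 1 := by
    rw [pow_mul, hk']
    ext
    simpa using hx
  have hdvd : 9 ∣ k * 3 := by
    refine dvd_trans ?_ (orderOf_dvd_of_pow_eq_one h3)
    rwa [hg, Nat.card_units]
  obtain ⟨j, rfl⟩ : 3 ∣ k := by omega
  refine ⟨((g ^ j : Lˣ) : L), ?_⟩
  have := congrArg (Units.val) hk'
  rw [← Units.val_pow_eq_pow_val, ← pow_mul, mul_comm j 3, this, Units.val_mk0]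

theorem mod_nine_eq_one_of_forall_prime_dvd (m : ℕ) (hm : m ≠ 0)
    (h : ∀ q : ℕ, q.Prime → q ∣ m → q % 9 = 1) : m % 9 = 1 := by
  induction m using Nat.recOnMul with
  | zero => exact absurd rfl hm
  | one => rfl
  | prime p hp => exact h p hp dvd_rfl
  | mul a b ha hb =>
    have ha' := ha (left_ne_zero_of_mul hm) fun q hq hd => h q hq (hd.mul_right b)
    have hb' := hb (right_ne_zero_of_mul hm) fun q hq hd => h q hq (hd.mul_left a)
    rw [Nat.mul_mod, ha', hb']

theorem cube_eq_one_of_sq_add_add_one_eq_zero {R : Type*} [CommRing R] {ρ : R}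
    (h : ρ ^ 2 + ρ + 1 = 0) : ρ ^ 3 = 1 := by
  linear_combination (ρ - 1) * h

theorem natCast_zmod_ne_zero_of_lt {p k : ℕ} (hk : k ≠ 0) (h : k < p) : (k : ZMod p) ≠ 0 := by
  rw [Ne, ZMod.natCast_eq_zero_iff]
  exact Nat.not_dvd_of_pos_of_lt (Nat.pos_of_ne_zero hk) h

/-- A primitive third root of unity in `ZMod p` forces `p ≡ 1 [MOD 3]`. -/
theorem mod_three_eq_one_of_sq_add_add_one_eq_zero {p : ℕ} [Fact p.Prime] (hp : 3 < p)
    {ρ : ZMod p} (h : ρ ^ 2 + ρ + 1 = 0) : p % 3 = 1 := by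
  have h3 := cube_eq_one_of_sq_add_add_one_eq_zero h
  have h1 : ρ ≠ 1 := by
    rintro rfl
    apply natCast_zmod_ne_zero_of_lt (by norm_num : 3 ≠ 0) hp
    push_cast
    linear_combination h
  have h0 : ρ ≠ 0 := by
    rintro rfl
    simp at h
  have ho := ZMod.orderOf_dvd_card_sub_one h0
  rw [orderOf_eq_prime h3 h1] at ho
  omega

/-- There are arbitrarily large primes `p ≡ 4, 7 [MOD 9]` for which `-5 / 23` times a primitive
third root of unity is a sixth power modulo `p`. -/
theorem exists_prime_gt_sixth_power (N : ℕ) (hN : 30 ≤ N) :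
    ∃ p : ℕ, N < p ∧ (p % 9 = 4 ∨ p % 9 = 7) ∧ p.Prime ∧
      ∃ ρ n : ZMod p, ρ ^ 2 + ρ + 1 = 0 ∧ 5 * ρ = -23 * n ^ 6 := by
  set n : ℕ := ordCompl[5] N.factorial with hn
  have hnpos : 0 < n := Nat.ordCompl_pos 5 (Nat.factorial_ne_zero N)
  have hn5 : ¬ 5 ∣ n := Nat.not_dvd_ordCompl (by norm_num) (Nat.factorial_ne_zero N)
  obtain ⟨m, hm⟩ : ∃ m : ℕ, m + 115 * n ^ 6 = 529 * n ^ 12 + 25 := by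
    refine ⟨529 * n ^ 12 + 25 - 115 * n ^ 6, Nat.sub_add_cancel ?_⟩
    nlinarith [Nat.one_le_pow 6 n hnpos]
  have hm9 : m % 9 = 7 := by
    have key : ∀ x y : ZMod 9, y + 115 * x ^ 6 = 529 * x ^ 12 + 25 → y = 7 := by decide
    have := key n m (by exact_mod_cast congrArg (Nat.cast : ℕ → ZMod 9) hm)
    have h7 : ((m : ℕ) : ZMod 9) = ((7 : ℕ) : ZMod 9) := by exact_mod_cast this
    exact (ZMod.natCast_eq_natCast_iff' _ _ _).1 h7
  have hcast : ∀ q : ℕ, q ∣ m → (115 * n ^ 6 : ZMod q) = 529 * n ^ 12 + 25 := by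
    intro q hq
    have h0 : (m : ZMod q) = 0 := (ZMod.natCast_eq_zero_iff _ _).2 hq
    have := congrArg (Nat.cast : ℕ → ZMod q) hm
    push_cast at this
    rwa [h0, zero_add] at this
  have hbig : ∀ q : ℕ, q.Prime → q ∣ m → N < q := by
    intro q hq hqm
    by_contra! hle
    by_cases h5 : q = 5
    · subst h5
      have key : ∀ x : ZMod 5, 115 * x ^ 6 = 529 * x ^ 12 + 25 → x = 0 := by decide
      exact hn5 ((ZMod.natCast_eq_zero_iff _ _).1 (key n (hcast 5 hqm)))
    · have hqn : q ∣ n := by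
        have h1 : q ∣ 5 ^ (N.factorial).factorization 5 * n := by
          rw [hn, Nat.ordProj_mul_ordCompl_eq_self]
          exact hq.dvd_factorial.2 hle
        refine Nat.Coprime.dvd_of_dvd_mul_left ?_ h1
        exact Nat.Coprime.pow_right _ ((Nat.coprime_primes hq (by norm_num)).2 h5)
      have h25 := hcast q hqm
      rw [(ZMod.natCast_eq_zero_iff n q).2 hqn] at h25
      have : ((5 ^ 2 : ℕ) : ZMod q) = 0 := by
        push_cast
        linear_combination -h25
      exact h5 ((Nat.prime_dvd_prime_iff_eq hq (by norm_num)).1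
        (hq.dvd_of_dvd_pow ((ZMod.natCast_eq_zero_iff _ _).1 this)))
  have hroot : ∀ q : ℕ, q.Prime → q ∣ m →
      ∃ ρ n : ZMod q, ρ ^ 2 + ρ + 1 = 0 ∧ 5 * ρ = -23 * n ^ 6 := by
    intro q hq hqm
    have : Fact q.Prime := ⟨hq⟩
    have h5 : (5 : ZMod q) ≠ 0 := by
      exact_mod_cast natCast_zmod_ne_zero_of_lt (by norm_num : 5 ≠ 0)
        (by have := hbig q hq hqm; omega)
    refine ⟨-23 * n ^ 6 / 5, n, ?_, by field_simp⟩
    field_simp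
    linear_combination -hcast q hqm
  obtain ⟨p, hp, hpm, hp9⟩ : ∃ p : ℕ, p.Prime ∧ p ∣ m ∧ p % 9 ≠ 1 := by
    by_contra! hall
    have := mod_nine_eq_one_of_forall_prime_dvd m (by omega) hall
    omega
  obtain ⟨ρ, x, hρ, hx⟩ := hroot p hp hpm
  have : Fact p.Prime := ⟨hp⟩
  have hbp := hbig p hp hpm
  have := mod_three_eq_one_of_sq_add_add_one_eq_zero (by omega) hρ
  exact ⟨p, hbp, by omega, hp, ρ, x, hρ, hx⟩

section Kummer

variable {p : ℕ} [Fact p.Prime] {L : Type*} [Field L] [Algebra (ZMod p) L]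

/-- The element of the cubic extension with coordinates `a, b, c` in the basis `1, τ, τ ^ 2`. -/
def kummerElt (τ : L) (a b c : ZMod p) : L :=
  algebraMap (ZMod p) L a + algebraMap (ZMod p) L b * τ + algebraMap (ZMod p) L c * τ ^ 2

theorem kummerElt_add (τ : L) (a b c a' b' c' : ZMod p) :
    kummerElt τ a b c + kummerElt τ a' b' c' = kummerElt τ (a + a') (b + b') (c + c') := by
  simp only [kummerElt, map_add]
  ring

theorem kummerElt_pow_card {τ : L} {ζ : ZMod p} (hτ : τ ^ p = algebraMap (ZMod p) L ζ * τ)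
    (a b c : ZMod p) :
    kummerElt τ a b c ^ p = kummerElt τ a (b * ζ) (c * ζ ^ 2) := by
  have : CharP L p := charP_of_injective_algebraMap (algebraMap (ZMod p) L).injective p
  simp only [kummerElt, add_pow_char, mul_pow, ← map_pow, ZMod.pow_card]
  rw [← pow_mul, mul_comm 2 p, pow_mul, hτ]
  simp only [map_mul, map_pow]
  ring

/-- The norm of `a + b τ + c τ ^ 2` in the Kummer extension generated by `τ`, `τ ^ 3 = e`. -/
theorem norm_kummerElt [Finite L] (hL : Module.finrank (ZMod p) L = 3) {τ : L} {ζ e : ZMod p}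
    (hζ : ζ ^ 2 + ζ + 1 = 0) (hτ : τ ^ p = algebraMap (ZMod p) L ζ * τ)
    (he : τ ^ 3 = algebraMap (ZMod p) L e) (a b c : ZMod p) :
    Algebra.norm (ZMod p) (kummerElt τ a b c) =
      a ^ 3 + e * b ^ 3 + e ^ 2 * c ^ 3 - 3 * e * a * b * c := by
  apply (algebraMap (ZMod p) L).injective
  rw [FiniteField.algebraMap_norm_eq_prod_pow, hL]
  simp only [Finset.prod_range_succ, Finset.prod_range_zero, Nat.card_zmod, pow_zero, one_mul,
    pow_one]
  rw [pow_two p, pow_mul, kummerElt_pow_card hτ, kummerElt_pow_card hτ]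
  have hζ' : (algebraMap (ZMod p) L ζ) ^ 2 = - algebraMap (ZMod p) L ζ - 1 := by
    have := congrArg (algebraMap (ZMod p) L) hζ
    simp only [map_add, map_pow, map_one, map_zero] at this
    linear_combination this
  simp only [kummerElt, map_add, map_sub, map_mul, map_pow, map_ofNat, ← he]
  grind

/-- The elements `1, τ, τ ^ 2` are linearly independent. -/
theorem kummerElt_injective (h3 : (3 : ZMod p) ≠ 0) {τ : L} (h0 : τ ≠ 0) {ζ : ZMod p}
    (hζ : ζ ^ 2 + ζ + 1 = 0) (hτ : τ ^ p = algebraMap (ZMod p) L ζ * τ)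
    {a b c a' b' c' : ZMod p} (h : kummerElt τ a b c = kummerElt τ a' b' c') :
    a = a' ∧ b = b' ∧ c = c' := by
  have h1 := congrArg (· ^ p) h
  simp only [kummerElt_pow_card hτ] at h1
  have h2 := congrArg (· ^ p) h1
  simp only [kummerElt_pow_card hτ] at h2
  have hζ' : (algebraMap (ZMod p) L ζ) ^ 2 = - algebraMap (ZMod p) L ζ - 1 := by
    have := congrArg (algebraMap (ZMod p) L) hζ
    simp only [map_add, map_pow, map_one, map_zero] at this
    linear_combination this
  have h3' : (3 : L) ≠ 0 := by
    rw [← map_ofNat (algebraMap (ZMod p) L) 3]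
    exact (_root_.map_ne_zero _).2 h3
  simp only [kummerElt, map_mul, map_pow] at h h1 h2
  have inj := (algebraMap (ZMod p) L).injective
  refine ⟨inj (mul_left_cancel₀ h3' ?_), inj (mul_left_cancel₀ (mul_ne_zero h3' h0) ?_),
    inj (mul_left_cancel₀ (mul_ne_zero h3' (pow_ne_zero 2 h0)) ?_)⟩
  · grind
  · grind
  · grind

end Kummer

/-- After inverting coordinates, the vertex at infinity and the points `θ i` have the points `X j`
as common neighbours as soon as `N (X j + θ i) / N (θ i)` is a nonzero constant. -/
theorem containsKst_of_norm_add {K L : Type} [Field K] [Field L] [Algebra K L]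
    [FiniteDimensional K L] {ι κ : Type} [Fintype ι] [Fintype κ] {θ : ι → L} {X : κ → L}
    (hθ : Function.Injective θ) (hX : Function.Injective X) (hθ0 : ∀ i, θ i ≠ 0)
    (hX0 : ∀ j, X j ≠ 0) (hXθ : ∀ j i, X j ≠ θ i) {d : K} (hd : d ≠ 0)
    (h : ∀ j i, Algebra.norm K (X j + θ i) = d * Algebra.norm K (θ i)) :
    ContainsKst (projNormGraph K L) (Fintype.card ι + 1) (Fintype.card κ) := by
  classical
  let f : Option ι → L × Kˣ := fun o => o.elim (0, 1) fun i => ((θ i)⁻¹, Units.mk0 d hd)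
  let g : κ → L × Kˣ := fun j => ((X j)⁻¹, Units.mk0 (Algebra.norm K (X j)⁻¹)
    (Algebra.norm_ne_zero_iff.2 (inv_ne_zero (hX0 j))))
  have hf : Function.Injective f := by
    rintro (_ | i) (_ | i') hii
    · rfl
    · exact absurd (congrArg Prod.fst hii).symm (inv_ne_zero (hθ0 i'))
    · exact absurd (congrArg Prod.fst hii) (inv_ne_zero (hθ0 i))
    · exact congrArg some (hθ (inv_injective (congrArg Prod.fst hii)))
  have hg : Function.Injective g := fun j j' hjj =>
    hX (inv_injective (congrArg Prod.fst hjj))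
  have hfg : ∀ o j, f o ≠ g j := by
    rintro (_ | i) j hij
    · exact inv_ne_zero (hX0 j) (congrArg Prod.fst hij).symm
    · exact hXθ j i (inv_injective (congrArg Prod.fst hij)).symm
  refine ⟨Finset.univ.image f, Finset.univ.image g, ?_, ?_, ?_, ?_⟩
  · rw [Finset.disjoint_left]
    intro v hv hv'
    obtain ⟨o, -, rfl⟩ := Finset.mem_image.1 hv
    obtain ⟨j, -, hj⟩ := Finset.mem_image.1 hv'
    exact hfg o j hj.symm
  · rw [Finset.card_image_of_injective _ hf, Finset.card_univ, Fintype.card_option]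
  · rw [Finset.card_image_of_injective _ hg, Finset.card_univ]
  · intro v hv w hw
    obtain ⟨o, -, rfl⟩ := Finset.mem_image.1 hv
    obtain ⟨j, -, rfl⟩ := Finset.mem_image.1 hw
    rw [projNormGraph, SimpleGraph.fromRel_adj]
    refine ⟨hfg o j, Or.inl ?_⟩
    rcases o with _ | i
    · simp [f, g]
    · have hsum : (θ i)⁻¹ + (X j)⁻¹ = (X j + θ i) * (θ i)⁻¹ * (X j)⁻¹ := by
        have := hθ0 i
        have := hX0 j
        field_simp
      have hn : Algebra.norm K (θ i) * Algebra.norm K (θ i)⁻¹ = 1 := by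
        rw [← map_mul, mul_inv_cancel₀ (hθ0 i), map_one]
      change Algebra.norm K ((θ i)⁻¹ + (X j)⁻¹) = d * Algebra.norm K (X j)⁻¹
      rw [hsum, map_mul, map_mul, h, mul_assoc d, hn, mul_one]

theorem pow_fin_three_injective {K : Type*} [Field K] {ρ : K} (h1 : ρ ≠ 1) (h3 : ρ ^ 3 = 1) :
    Function.Injective fun i : Fin 3 => ρ ^ (i : ℕ) := by
  have ho : orderOf ρ = 3 := orderOf_eq_prime h3 h1
  intro i j hij
  exact Fin.ext (pow_injOn_Iio_orderOf (by simp [ho]) (by simp [ho]) hij)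

/-- The polynomial identity behind the second triple of points of the `K_{4,6}`. -/
theorem norm_identity_of_sq {K : Type*} [Field K] {q e κ : K} (hq : q ^ 3 = 1)
    (he : 23 * e ^ 2 = -5) (he8 : 1 - 8 * e ≠ 0) (hκ : κ * (1 - 8 * e) = 1 - e) :
    (e + κ) ^ 3 + e * (2 * κ * q + 1) ^ 3 + e ^ 2 * (4 * κ * q ^ 2 + 1) ^ 3 -
      3 * e * (e + κ) * (2 * κ * q + 1) * (4 * κ * q ^ 2 + 1) = (1 + e) * (1 + e ^ 2) := by
  apply mul_left_cancel₀ (pow_ne_zero 3 he8)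
  trans (e * (1 - 8 * e) + κ * (1 - 8 * e)) ^ 3 +
      e * (2 * (κ * (1 - 8 * e)) * q + (1 - 8 * e)) ^ 3 +
      e ^ 2 * (4 * (κ * (1 - 8 * e)) * q ^ 2 + (1 - 8 * e)) ^ 3 -
      3 * e * (e * (1 - 8 * e) + κ * (1 - 8 * e)) * (2 * (κ * (1 - 8 * e)) * q + (1 - 8 * e)) *
        (4 * (κ * (1 - 8 * e)) * q ^ 2 + (1 - 8 * e))
  · ring
  rw [hκ]
  linear_combination (8 * e * (1 - e) ^ 3 + 64 * e ^ 2 * (1 - e) ^ 3 * (q ^ 3 + 1) +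
    48 * e ^ 2 * (1 - e) ^ 2 * (1 - 8 * e) * q - 24 * e * (1 - 8 * e ^ 2) * (1 - e) ^ 2) * hq +
    (64 * e ^ 3 - 16 * e ^ 2 + e) * he

/-- The explicit `K_{4,6}` in a Kummer extension generated by `τ` with `23 τ ^ 6 = -5`. -/
theorem containsKst_four_six_of_kummer {p : ℕ} [Fact p.Prime] (hp : 20000 < p) {L : Type}
    [Field L] [Finite L] [Algebra (ZMod p) L] (hL : Module.finrank (ZMod p) L = 3)
    {τ : L} {ζ e ρ : ZMod p} (hζ : ζ ^ 2 + ζ + 1 = 0) (hρ : ρ ^ 2 + ρ + 1 = 0)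
    (hτ : τ ^ p = algebraMap (ZMod p) L ζ * τ) (hτe : τ ^ 3 = algebraMap (ZMod p) L e)
    (he : 23 * e ^ 2 = -5) :
    ContainsKst (projNormGraph (ZMod p) L) 4 6 := by
  have hnum : ∀ k : ℕ, k ≠ 0 → k ≤ 20000 → (k : ZMod p) ≠ 0 := fun k hk hk' =>
    natCast_zmod_ne_zero_of_lt hk (by omega)
  have h2 : (2 : ZMod p) ≠ 0 := by exact_mod_cast hnum 2 (by norm_num) (by norm_num)
  have h3 : (3 : ZMod p) ≠ 0 := by exact_mod_cast hnum 3 (by norm_num) (by norm_num)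
  have h5 : (5 : ZMod p) ≠ 0 := by exact_mod_cast hnum 5 (by norm_num) (by norm_num)
  have h7 : (7 : ZMod p) ≠ 0 := by exact_mod_cast hnum 7 (by norm_num) (by norm_num)
  have h18 : (18 : ZMod p) ≠ 0 := by exact_mod_cast hnum 18 (by norm_num) (by norm_num)
  have h28 : (28 : ZMod p) ≠ 0 := by exact_mod_cast hnum 28 (by norm_num) (by norm_num)
  have h343 : (343 : ZMod p) ≠ 0 := by exact_mod_cast hnum 343 (by norm_num) (by norm_num)
  have h12292 : (12292 : ZMod p) ≠ 0 := by exact_mod_cast hnum 12292 (by norm_num) (by norm_num)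
  have he0 : e ≠ 0 := by
    rintro rfl
    exact h5 (by linear_combination he)
  have he1 : 1 - e ≠ 0 := fun h => h28 (by linear_combination he + 23 * (1 + e) * h)
  have he2 : 1 + e ^ 2 ≠ 0 := fun h => h18 (by linear_combination 23 * h - he)
  have he8 : 1 - 8 * e ≠ 0 := fun h => h343 (by
    linear_combination 23 * (1 + 8 * e) * h + 64 * he)
  have he6 : e ^ 6 ≠ 1 := fun h => h12292 (by
    linear_combination -12167 * h + ((23 * e ^ 2) ^ 2 - 5 * (23 * e ^ 2) + 25) * he)
  have hτ0 : τ ≠ 0 := by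
    rintro rfl
    rw [zero_pow (by norm_num), eq_comm, map_eq_zero] at hτe
    exact he0 hτe
  have hρ3 := cube_eq_one_of_sq_add_add_one_eq_zero hρ
  have hρ1 : ρ ≠ 1 := by
    rintro rfl
    exact h3 (by linear_combination hρ)
  have hinj := pow_fin_three_injective hρ1 hρ3
  have hroot : ∀ i : Fin 3, (ρ ^ (i : ℕ)) ^ 3 = 1 := fun i => by
    rw [← pow_mul, mul_comm, pow_mul, hρ3, one_pow]
  have hroot0 : ∀ i : Fin 3, ρ ^ (i : ℕ) ≠ 0 := fun i h => by
    simpa [h] using hroot i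
  obtain ⟨κ, hκ⟩ : ∃ κ, κ * (1 - 8 * e) = 1 - e := ⟨(1 - e) / (1 - 8 * e), div_mul_cancel₀ _ he8⟩
  have hκ0 : κ ≠ 0 := by
    rintro rfl
    exact he1 (by linear_combination -hκ)
  let θ : Fin 3 → L := fun i => kummerElt τ 0 (ρ ^ (i : ℕ)) ((ρ ^ (i : ℕ)) ^ 2)
  let X : Fin 3 ⊕ Fin 3 → L := Sum.elim
    (fun i => kummerElt τ (ρ ^ (i : ℕ) + (ρ ^ (i : ℕ)) ^ 2 * e) 0 0)
    (fun i => kummerElt τ (e + κ) (2 * κ * ρ ^ (i : ℕ)) (4 * κ * (ρ ^ (i : ℕ)) ^ 2))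
  have hzero : (0 : L) = kummerElt (p := p) τ 0 0 0 := by simp [kummerElt]
  have coord {a b c a' b' c' : ZMod p} (h : kummerElt τ a b c = kummerElt τ a' b' c') :=
    kummerElt_injective h3 hτ0 hζ hτ h
  have hsplit : ∀ i j : Fin 3, i ≠ j →
      1 + (ρ ^ (i : ℕ) + ρ ^ (j : ℕ)) * e ≠ 0 := by
    intro i j hij h
    have hsub : ρ ^ (i : ℕ) - ρ ^ (j : ℕ) ≠ 0 := sub_ne_zero.2 fun h' => hij (hinj h')
    have hi := hroot i
    have hj := hroot j
    generalize ρ ^ (i : ℕ) = r at *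
    generalize ρ ^ (j : ℕ) = s at *
    have hrs : r ^ 2 + r * s + s ^ 2 = 0 := by
      apply mul_left_cancel₀ hsub
      linear_combination hi - hj
    have hcube : (r + s) ^ 3 = -1 := by linear_combination (r + 2 * s) * hrs - hj
    have : e ^ 3 = 1 := by
      linear_combination (e ^ 3) * hcube - ((r + s) ^ 2 * e ^ 2 - (r + s) * e + 1) * h
    exact he6 (by linear_combination (e ^ 3 + 1) * this)
  refine containsKst_of_norm_add (ι := Fin 3) (κ := Fin 3 ⊕ Fin 3) (θ := θ) (X := X)
    (d := (1 + e ^ 2) / e) ?_ ?_ ?_ ?_ ?_ (div_ne_zero he2 he0) ?_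
  · intro i j hij
    exact hinj (coord hij).2.1
  · rintro (i | i) (j | j) hij
    · by_contra hne
      have hne' : i ≠ j := fun h => hne (congrArg Sum.inl h)
      have hsub : ρ ^ (i : ℕ) - ρ ^ (j : ℕ) ≠ 0 := sub_ne_zero.2 fun h' => hne' (hinj h')
      refine mul_ne_zero hsub (hsplit i j hne') ?_
      linear_combination (coord hij).1
    · exact absurd (coord hij).2.1.symm (mul_ne_zero (mul_ne_zero h2 hκ0) (hroot0 j))
    · exact absurd (coord hij).2.1 (mul_ne_zero (mul_ne_zero h2 hκ0) (hroot0 i))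
    · exact congrArg Sum.inr (hinj (mul_left_cancel₀ (mul_ne_zero h2 hκ0) (coord hij).2.1))
  · intro i h
    exact hroot0 i (coord (h.trans hzero)).2.1
  · rintro (i | i) h
    · have h1 := (coord (h.trans hzero)).1
      have hi := hroot i
      have h2' : 1 + ρ ^ (i : ℕ) * e = 0 := by
        apply mul_left_cancel₀ (hroot0 i)
        linear_combination h1
      generalize ρ ^ (i : ℕ) = r at *
      have h3' : e ^ 3 = -1 := by
        linear_combination (1 - r * e + r ^ 2 * e ^ 2) * h2' - e ^ 3 * hi
      exact he6 (by linear_combination (e ^ 3 - 1) * h3')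
    · exact mul_ne_zero (mul_ne_zero h2 hκ0) (hroot0 i) (coord (h.trans hzero)).2.1
  · rintro (j | j) i h
    · exact hroot0 i (coord h).2.1.symm
    · obtain ⟨-, hb, hc⟩ := coord h
      have hi := hroot i
      have hj := hroot j
      have hi0 := hroot0 i
      generalize ρ ^ (i : ℕ) = r at *
      generalize ρ ^ (j : ℕ) = s at *
      have hrs : 2 * s = r := by
        apply mul_left_cancel₀ hi0
        rw [← hb] at hc ⊢
        apply mul_left_cancel₀ (mul_ne_zero h2 hκ0)
        linear_combination 2 * κ * hc
      apply h7
      rw [← hrs] at hi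
      linear_combination hi - 8 * hj
  · rintro (j | j) i
    · change Algebra.norm (ZMod p) (kummerElt _ _ _ _ + kummerElt _ _ _ _) =
        _ * Algebra.norm (ZMod p) (kummerElt _ _ _ _)
      rw [kummerElt_add, norm_kummerElt hL hζ hτ hτe, norm_kummerElt hL hζ hτ hτe]
      have hi := hroot i
      have hj := hroot j
      generalize ρ ^ (i : ℕ) = r at *
      generalize ρ ^ (j : ℕ) = s at *
      rw [div_mul_eq_mul_div, eq_div_iff he0]
      linear_combination e * (1 + 3 * e * s + 3 * e ^ 2 * s ^ 2 + e ^ 3 * (s ^ 3 + 1)) * hj +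
        (e * (e + e ^ 2 * (r ^ 3 + 1) - 3 * e * (s + s ^ 2 * e)) -
        (1 + e ^ 2) * (e + e ^ 2 * (r ^ 3 + 1))) * hi
    · change Algebra.norm (ZMod p) (kummerElt _ _ _ _ + kummerElt _ _ _ _) =
        _ * Algebra.norm (ZMod p) (kummerElt _ _ _ _)
      rw [kummerElt_add, norm_kummerElt hL hζ hτ hτe, norm_kummerElt hL hζ hτ hτe]
      have hi := hroot i
      have hj := hroot j
      generalize ρ ^ (i : ℕ) = r at *
      generalize ρ ^ (j : ℕ) = s at *
      have hT : (s * r ^ 2) ^ 3 = 1 := by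
        linear_combination (r ^ 3 + 1) * hi + r ^ 6 * hj
      have hs : s = s * r ^ 2 * r := by linear_combination -s * hi
      generalize s * r ^ 2 = q at *
      subst hs
      have key := norm_identity_of_sq hT he he8 hκ
      rw [div_mul_eq_mul_div, eq_div_iff he0]
      linear_combination e * key + (e * (e * (2 * κ * q + 1) ^ 3 +
        e ^ 2 * (r ^ 3 + 1) * (4 * κ * q ^ 2 + 1) ^ 3 -
        3 * e * (e + κ) * (2 * κ * q + 1) * (4 * κ * q ^ 2 + 1)) -
        (1 + e ^ 2) * (e + e ^ 2 * (r ^ 3 + 1))) * hi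

/-- There are infinitely many primes `p` such that the projective norm graph
`P(p, 4)` (on `F_{p^3} × F_pˣ`) contains a copy of `K_{4,6}`. -/
theorem infinitely_many_primes_K46 :
    {p : ℕ | ∃ hp : p.Prime,
      haveI : Fact p.Prime := ⟨hp⟩
      ContainsKst (projNormGraph (ZMod p) (GaloisField p 3)) 4 6}.Infinite := by
  refine Set.infinite_of_not_bddAbove fun ⟨N, hN⟩ => ?_
  obtain ⟨p, hpN, hp9, hp, ρ, n, hρ, hn⟩ := exists_prime_gt_sixth_power (N + 20000) (by omega)
  have : Fact p.Prime := ⟨hp⟩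
  refine absurd (hN (a := p) ⟨hp, ?_⟩) (by omega)
  have hcard : Nat.card (GaloisField p 3) = p ^ 3 := GaloisField.card p 3 (by norm_num)
  have h9 : 9 ∣ Nat.card (GaloisField p 3) - 1 := by
    rw [hcard, ← Nat.modEq_iff_dvd' (Nat.one_le_pow _ _ hp.pos), Nat.ModEq, Nat.pow_mod]
    rcases hp9 with h | h <;> rw [h]
  have hρ3 := cube_eq_one_of_sq_add_add_one_eq_zero hρ
  obtain ⟨t, ht⟩ := exists_cube_eq_of_cube_eq_one h9
    (x := algebraMap (ZMod p) (GaloisField p 3) ρ) (by rw [← map_pow, hρ3, map_one])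
  obtain ⟨ζ, hζ, htp⟩ : ∃ ζ : ZMod p, ζ ^ 2 + ζ + 1 = 0 ∧
      t ^ p = algebraMap (ZMod p) (GaloisField p 3) ζ * t := by
    have ht' : ∀ k, t ^ (3 * k + 1) = algebraMap (ZMod p) (GaloisField p 3) (ρ ^ k) * t :=
      fun k => by rw [pow_succ, pow_mul, ht, map_pow]
    rcases hp9 with h | h
    · refine ⟨ρ, hρ, ?_⟩
      have := ht' (3 * (p / 9) + 1)
      rwa [pow_succ ρ, pow_mul ρ, hρ3, one_pow, one_mul,
        show 3 * (3 * (p / 9) + 1) + 1 = p by omega] at this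
    · refine ⟨ρ ^ 2, by linear_combination hρ + ρ * hρ3, ?_⟩
      have := ht' (3 * (p / 9) + 2)
      rwa [pow_add ρ, pow_mul ρ, hρ3, one_pow, one_mul,
        show 3 * (3 * (p / 9) + 2) + 1 = p by omega] at this
  refine containsKst_four_six_of_kummer (by omega) (GaloisField.finrank p (by norm_num))
    (τ := algebraMap (ZMod p) (GaloisField p 3) n * t) (e := n ^ 3 * ρ) hζ hρ ?_ ?_ ?_
  · rw [mul_pow, ← map_pow, ZMod.pow_card, htp]
    ring
  · rw [mul_pow, ht, map_mul, map_pow]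
  · linear_combination ρ ^ 2 * hn - 5 * hρ3
end

section
/- For any prime power q, any integer t ≥ 3, and any t distinct vertices of the projective norm graph P(q,t), the number of vertices adjacent to all t of them is at most (t−1)!. -/
open Polynomial

section SpanningModulo

variable (F : Type*) {R : Type*} [Field F] [CommRing R] [Algebra F R]

/-- The quotient `R ⧸ I` is spanned over `F` by the classes of at most `n` elements. -/
def Ideal.SpannedModuloBy (I : Ideal R) (n : ℕ) : Prop :=
  ∃ s : Finset R, s.card ≤ n ∧ ∀ x : R, ∃ y ∈ Submodule.span F (s : Set R), x - y ∈ I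

variable {F}

theorem Ideal.SpannedModuloBy.mono {I J : Ideal R} {m n : ℕ} (h : I.SpannedModuloBy F m)
    (hIJ : I ≤ J) (hmn : m ≤ n) : J.SpannedModuloBy F n := by
  obtain ⟨s, hs, h⟩ := h
  refine ⟨s, hs.trans hmn, fun x => ?_⟩
  obtain ⟨y, hy, hxy⟩ := h x
  exact ⟨y, hy, hIJ hxy⟩

theorem Ideal.spannedModuloBy_zero_of_one_mem {I : Ideal R} (h : (1 : R) ∈ I) :
    I.SpannedModuloBy F 0 := by
  refine ⟨∅, by simp, fun x => ⟨0, Submodule.zero_mem _, ?_⟩⟩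
  rw [(Ideal.eq_top_iff_one I).mpr h]
  trivial

theorem Ideal.SpannedModuloBy.of_mul_mem {I : Ideal R} {u v : R} {m n : ℕ} (huv : u * v ∈ I)
    (hu : (I ⊔ Ideal.span {u}).SpannedModuloBy F m)
    (hv : (I ⊔ Ideal.span {v}).SpannedModuloBy F n) : I.SpannedModuloBy F (m + n) := by
  classical
  obtain ⟨s, hs, hu⟩ := hu
  obtain ⟨s', hs', hv⟩ := hv
  refine ⟨s ∪ s'.image (u * ·), (Finset.card_union_le _ _).trans
    (add_le_add hs (Finset.card_image_le.trans hs')), fun x => ?_⟩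
  obtain ⟨y, hy, hxy⟩ := hu x
  obtain ⟨i, hi, z, hz, hiz⟩ := Submodule.mem_sup.mp hxy
  obtain ⟨z, rfl⟩ := Ideal.mem_span_singleton'.mp hz
  obtain ⟨y', hy', hzy'⟩ := hv z
  obtain ⟨i', hi', w, hw, hiw⟩ := Submodule.mem_sup.mp hzy'
  obtain ⟨w, rfl⟩ := Ideal.mem_span_singleton'.mp hw
  refine ⟨y + u * y', Submodule.add_mem _ (Submodule.span_mono (by simp) hy) ?_, ?_⟩
  · have h := Submodule.mem_map_of_mem (f := LinearMap.mulLeft F u) hy'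
    rw [Submodule.map_span] at h
    refine Submodule.span_mono ?_ h
    rw [Finset.coe_union, Finset.coe_image]
    exact Set.subset_union_right
  · have h : x - (y + u * y') = i + u * i' + w * (u * v) := by linear_combination -hiz - u * hiw
    rw [h]
    exact I.add_mem (I.add_mem hi (I.mul_mem_left _ hi')) (I.mul_mem_left _ huv)

theorem Ideal.SpannedModuloBy.of_prod_mem {ι : Type*} (s : Finset ι) (u : ι → R) (n : ι → ℕ)
    {I : Ideal R} (hI : ∏ j ∈ s, u j ∈ I)
    (h : ∀ j ∈ s, (I ⊔ Ideal.span {u j}).SpannedModuloBy F (n j)) :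
    I.SpannedModuloBy F (∑ j ∈ s, n j) := by
  classical
  induction s using Finset.induction_on generalizing I with
  | empty => exact Ideal.spannedModuloBy_zero_of_one_mem (by simpa using hI)
  | insert j s hj ih =>
    rw [Finset.prod_insert hj] at hI
    rw [Finset.sum_insert hj]
    refine .of_mul_mem hI (h j (Finset.mem_insert_self j s)) (ih ?_ fun k hk => ?_)
    · exact Ideal.mem_sup_right (Ideal.mem_span_singleton_self _)
    · exact (h k (Finset.mem_insert_of_mem hk)).mono (sup_le_sup_right le_sup_left _) le_rfl

end SpanningModulo

open MvPolynomial in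
theorem MvPolynomial.sub_C_eval_mem {F ι : Type*} [Field F] {I : Ideal (MvPolynomial ι F)}
    (c : ι → F) (h : ∀ j, X j - C (c j) ∈ I) (p : MvPolynomial ι F) : p - C (eval c p) ∈ I := by
  rw [← Ideal.Quotient.eq]
  induction p using MvPolynomial.induction_on with
  | C r => simp
  | add p q hp hq => simp [hp, hq]
  | mul_X p j hp => simp [hp, Ideal.Quotient.eq.mpr (h j)]

open MvPolynomial in
/-- Modulo the products `∏ j, (X j - a i j)` for `i ∈ T`, and with the variables outside `D` made
constant, the polynomial ring is spanned by `T.card !` elements. -/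
theorem MvPolynomial.spannedModuloBy_factorial {F ι κ : Type*} [Field F] [Fintype ι]
    (a : κ → ι → F) (ha : ∀ j, Function.Injective fun i => a i j) (T : Finset κ)
    (D : Finset ι) (hcard : D.card = T.card) (I : Ideal (MvPolynomial ι F))
    (hT : ∀ i ∈ T, ∏ j, (X j - C (a i j)) ∈ I)
    (hD : ∀ j ∉ D, ∃ c, X j - C c ∈ I ∧ ∀ i ∈ T, a i j ≠ c) :
    I.SpannedModuloBy F T.card.factorial := by
  classical
  induction T using Finset.induction_on generalizing D I with
  | empty =>
    obtain rfl : D = ∅ := by simpa using hcard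
    choose c hc using fun j => hD j (Finset.notMem_empty j)
    refine ⟨{1}, by simp, fun p => ⟨C (eval c p), ?_, sub_C_eval_mem c (fun j => (hc j).1) p⟩⟩
    rw [← mul_one (C _), ← smul_eq_C_mul]
    exact Submodule.smul_mem _ _ (Submodule.subset_span (by simp))
  | insert i T hi ih =>
    have hle (j : ι) := le_sup_left (a := I) (b := Ideal.span {X j - C (a i j)})
    have hmem (j : ι) : X j - C (a i j) ∈ I ⊔ Ideal.span {X j - C (a i j)} :=
      Ideal.mem_sup_right (Ideal.mem_span_singleton_self _)
    refine (Ideal.SpannedModuloBy.of_prod_mem Finset.univ (fun j => X j - C (a i j))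
      (fun j => if j ∈ D then T.card.factorial else 0)
      (hT i (Finset.mem_insert_self i T)) fun j _ => ?_).mono le_rfl ?_
    · split_ifs with hj
      · refine ih (D.erase j) ?_ _ (fun k hk => hle j (hT k (Finset.mem_insert_of_mem hk)))
          fun k hk => ?_
        · rw [Finset.card_erase_of_mem hj, hcard, Finset.card_insert_of_notMem hi,
            Nat.add_sub_cancel]
        · by_cases hkj : k = j
          · subst hkj
            exact ⟨a i k, hmem k, fun l hl hli => hi (ha k hli ▸ hl)⟩
          · obtain ⟨c, hc, hca⟩ := hD k fun hkD => hk (Finset.mem_erase.mpr ⟨hkj, hkD⟩)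
            exact ⟨c, hle j hc, fun l hl => hca l (Finset.mem_insert_of_mem hl)⟩
      · obtain ⟨c, hc, hca⟩ := hD j hj
        have hne := sub_ne_zero.mpr (hca i (Finset.mem_insert_self i T))
        refine Ideal.spannedModuloBy_zero_of_one_mem ?_
        have h := Ideal.mul_mem_left _ (C (a i j - c)⁻¹) (sub_mem (hle j hc) (hmem j))
        rwa [sub_sub_sub_cancel_left, ← C_sub, ← C_mul, inv_mul_cancel₀ hne, C_1] at h
    · rw [Finset.sum_ite_mem, Finset.univ_inter, Finset.sum_const, hcard,
        Finset.card_insert_of_notMem hi, Nat.factorial_succ, smul_eq_mul]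

/-- Coordinates of a system of products of translates of bounded valuation are themselves of
bounded valuation. -/
theorem Valuation.le_one_of_prod_sub_le_one {Q Γ ι κ : Type*} [Field Q]
    [LinearOrderedCommGroupWithZero Γ] [Fintype ι] [Fintype κ]
    (hcard : Fintype.card κ = Fintype.card ι) (v : Valuation Q Γ) (a : κ → ι → Q) (x : ι → Q)
    (ha : ∀ i j, v (a i j) ≤ 1) (hsub : ∀ i i' j, i ≠ i' → v (a i j - a i' j) = 1)
    (hprod : ∀ i, v (∏ j, (x j - a i j)) ≤ 1) (j : ι) : v (x j) ≤ 1 := by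
  classical
  by_contra! hj
  have hlt (i : κ) : 1 < v (x j - a i j) := by
    rwa [Valuation.map_sub_eq_of_lt_left v ((ha i j).trans_lt hj)]
  have hex (i : κ) : ∃ k, v (x k - a i k) < 1 := by
    by_contra! h
    refine (hprod i).not_gt ?_
    rw [map_prod, ← Finset.mul_prod_erase _ _ (Finset.mem_univ j)]
    exact one_lt_mul_of_lt_of_le' (hlt i) (Finset.one_le_prod' fun k _ => h k)
  choose k hk using hex
  have hinj : Function.Injective k := by
    intro i i' hii'
    by_contra hne
    refine (hsub i i' (k i) hne).not_lt ?_
    have h := Valuation.map_sub_lt v (hii' ▸ hk i') (hk i)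
    rwa [hii', sub_sub_sub_cancel_left, ← hii'] at h
  obtain ⟨i, rfl⟩ := ((Fintype.bijective_iff_injective_and_card k).mpr ⟨hinj, hcard⟩).2 j
  exact (hk i).not_gt (hlt i)

/-- An element of a domain finite over an integrally closed domain `A` is a root of a monic
polynomial over `A` of degree at most the number of generators modulo a proper ideal of `A`. -/
theorem minpoly.natDegree_le_of_le_span_sup_smul {A R : Type*} [CommRing A] [IsDomain A]
    [IsIntegrallyClosed A] [CommRing R] [IsDomain R] [Algebra A R] [Module.IsTorsionFree A R]
    [Module.Finite A R] {m : Ideal A} (hm : m ≠ ⊤) (s : Finset R)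
    (hs : (⊤ : Submodule A R) ≤ Submodule.span A (s : Set R) ⊔ m • ⊤) (h : R) :
    (minpoly A h).natDegree ≤ s.card := by
  obtain ⟨r, hr, hrs⟩ := Submodule.exists_sub_one_mem_and_smul_le_of_fg_of_le_sup
    Module.Finite.fg_top le_rfl hs
  have hr0 : r ≠ 0 := by
    rintro rfl
    exact hm ((Ideal.eq_top_iff_one m).mpr (by simpa using hr))
  have hdep : ¬ LinearIndependent A fun k : Fin (s.card + 1) => r • h ^ (k : ℕ) := by
    intro hli
    have hcard := linearIndependent_le_span' _ hli (s : Set R) (by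
      rintro _ ⟨k, rfl⟩
      exact hrs (Submodule.smul_mem_pointwise_smul _ r _ trivial))
    simp at hcard
  obtain ⟨g, hg, k, hk⟩ := Fintype.not_linearIndependent_iff.mp hdep
  set p : A[X] := ∑ k : Fin (s.card + 1), Polynomial.monomial (k : ℕ) (r * g k) with hp
  have hcoeff : p.coeff k = r * g k := by
    simp [hp, Polynomial.coeff_monomial, Fin.val_inj]
  have hp0 : p ≠ 0 := by
    intro h0
    rw [h0, Polynomial.coeff_zero] at hcoeff
    exact mul_ne_zero hr0 hk hcoeff.symm
  have hroot : Polynomial.aeval h p = 0 := by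
    rw [← hg, hp, map_sum]
    refine Finset.sum_congr rfl fun k _ => ?_
    rw [Polynomial.aeval_monomial, ← Algebra.smul_def, smul_smul, mul_comm r]
  refine (Polynomial.natDegree_le_natDegree
    (minpoly.IsIntegrallyClosed.degree_le_of_ne_zero hp0 hroot)).trans ?_
  refine Polynomial.natDegree_sum_le_of_forall_le _ _ fun k _ => ?_
  exact (Polynomial.natDegree_monomial_le _).trans (Nat.lt_succ_iff.mp k.2)

section TranslateProd

open MvPolynomial

variable {F ι κ : Type*} [Field F] [Fintype ι] [Fintype κ]

/-- The product of the translates `X j - a j` of all the variables. -/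
noncomputable def MvPolynomial.translateProd (a : ι → F) : MvPolynomial ι F :=
  ∏ j, (X j - C (a j))

/-- The subalgebra generated by the products of translates attached to the rows of `a`. -/
noncomputable abbrev MvPolynomial.translateAlgebra (a : κ → ι → F) :
    Subalgebra F (MvPolynomial ι F) :=
  Algebra.adjoin F (Set.range fun i => translateProd (a i))

theorem MvPolynomial.isIntegral_X_translateAlgebra (hcard : Fintype.card κ = Fintype.card ι)
    (a : κ → ι → F) (ha : ∀ j, Function.Injective fun i => a i j) (j : ι) :
    IsIntegral (translateAlgebra a) (X j : MvPolynomial ι F) := by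
  let Q := FractionRing (MvPolynomial ι F)
  let φ : MvPolynomial ι F →+* Q := algebraMap _ Q
  have hφ : Function.Injective φ := IsFractionRing.injective _ Q
  let A := translateAlgebra a
  rw [← isIntegral_algebraMap_iff (B := Q) hφ]
  by_contra hj
  have : IsIntegrallyClosedIn (integralClosure A Q).toSubring Q :=
    inferInstanceAs (IsIntegrallyClosedIn (integralClosure A Q) Q)
  obtain ⟨V, hV, hjV⟩ := Subring.exists_le_valuationSubring_of_isIntegrallyClosedIn
    (R := (integralClosure A Q).toSubring) hj
  have hA (p : MvPolynomial ι F) (hp : p ∈ A) : V.valuation (φ p) ≤ 1 :=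
    (V.valuation_le_one_iff _).mpr (hV (isIntegral_algebraMap (R := A) (A := Q) (x := ⟨p, hp⟩)))
  have hconst (c : F) : V.valuation (φ (C c)) ≤ 1 := hA _ (A.algebraMap_mem c)
  refine hjV ((V.valuation_le_one_iff _).mp (Valuation.le_one_of_prod_sub_le_one hcard V.valuation
    (fun i j => φ (C (a i j))) (fun j => φ (X j)) (fun i j => hconst _) ?_ ?_ j))
  · intro i i' j hii'
    have hne : a i j - a i' j ≠ 0 := sub_ne_zero.mpr fun h => hii' (ha j h)
    rw [← map_sub, ← C_sub]
    refine le_antisymm (hconst _) ?_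
    calc 1 = V.valuation (φ (C (a i j - a i' j))) * V.valuation (φ (C (a i j - a i' j)⁻¹)) := by
          rw [← map_mul, ← map_mul, ← C_mul, mul_inv_cancel₀ hne, C_1, map_one, map_one]
      _ ≤ _ := mul_le_of_le_one_right' (hconst _)
  · intro i
    have h := hA (translateProd (a i)) (Algebra.subset_adjoin ⟨i, rfl⟩)
    simpa only [translateProd, map_prod, map_sub] using h

theorem MvPolynomial.isIntegral_translateAlgebra (hcard : Fintype.card κ = Fintype.card ι)
    (a : κ → ι → F) (ha : ∀ j, Function.Injective fun i => a i j) :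
    Algebra.IsIntegral (translateAlgebra a) (MvPolynomial ι F) := by
  refine ⟨fun p => ?_⟩
  induction p using MvPolynomial.induction_on with
  | C c => exact isIntegral_algebraMap (x := algebraMap F (translateAlgebra a) c)
  | add p q hp hq => exact hp.add hq
  | mul_X p j hp => exact hp.mul (isIntegral_X_translateAlgebra hcard a ha j)

theorem MvPolynomial.algebraicIndependent_translateProd (hcard : Fintype.card κ = Fintype.card ι)
    (a : κ → ι → F) (ha : ∀ j, Function.Injective fun i => a i j) :
    AlgebraicIndependent F fun i => translateProd (a i) := by
  have := isIntegral_translateAlgebra hcard a ha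
  refine (Algebra.IsAlgebraic.isTranscendenceBasis_of_lift_le_trdeg_of_finite F _ ?_).1
  rw [MvPolynomial.trdeg_of_isDomain]
  simp [hcard]

theorem MvPolynomial.isIntegrallyClosed_translateAlgebra (hcard : Fintype.card κ = Fintype.card ι)
    (a : κ → ι → F) (ha : ∀ j, Function.Injective fun i => a i j) :
    IsIntegrallyClosed (translateAlgebra a) := by
  have := (algebraicIndependent_translateProd hcard a ha).aevalEquiv.toMulEquiv
    |>.uniqueFactorizationMonoid inferInstance
  exact GCDMonoid.toIsIntegrallyClosed

theorem MvPolynomial.natDegree_minpoly_translateAlgebra_le (hcard : Fintype.card κ = Fintype.card ι)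
    (a : κ → ι → F) (ha : ∀ j, Function.Injective fun i => a i j)
    (p : MvPolynomial ι F) :
    (minpoly (translateAlgebra a) p).natDegree ≤ (Fintype.card ι).factorial := by
  classical
  let A := translateAlgebra a
  have := isIntegral_translateAlgebra hcard a ha
  have := isIntegrallyClosed_translateAlgebra hcard a ha
  have : Algebra.FiniteType A (MvPolynomial ι F) :=
    Algebra.FiniteType.of_restrictScalars_finiteType F A _
  have : Module.Finite A (MvPolynomial ι F) := Algebra.IsIntegral.finite
  let f (i : κ) : A := ⟨translateProd (a i), Algebra.subset_adjoin ⟨i, rfl⟩⟩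
  obtain ⟨e⟩ := Fintype.card_eq.mp hcard
  let ev : A →+* F := (eval fun j => a (e.symm j) j).comp A.val.toRingHom
  have hev : Ideal.span (Set.range f) ≤ RingHom.ker ev := by
    rw [Ideal.span_le]
    rintro _ ⟨i, rfl⟩
    change eval _ (translateProd (a i)) = 0
    rw [translateProd, map_prod]
    exact Finset.prod_eq_zero (Finset.mem_univ (e i)) (by simp)
  have htop : Ideal.span (Set.range f) ≠ ⊤ := fun h =>
    RingHom.ker_ne_top ev (top_unique (h ▸ hev))
  obtain ⟨s, hs, hspan⟩ := spannedModuloBy_factorial a ha Finset.univ Finset.univ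
    (by simpa using hcard.symm) (Ideal.span (Set.range fun i => translateProd (a i)))
    (fun i _ => Ideal.subset_span ⟨i, rfl⟩) (by simp)
  rw [Finset.card_univ, hcard] at hs
  refine (minpoly.natDegree_le_of_le_span_sup_smul htop s (fun x _ => ?_) p).trans hs
  obtain ⟨y, hy, hxy⟩ := hspan x
  rw [← add_sub_cancel y x]
  refine Submodule.add_mem_sup (Submodule.span_le_restrictScalars F A _ hy) ?_
  generalize x - y = z at hxy
  induction hxy using Submodule.span_induction with
  | mem z hz =>
    obtain ⟨i, rfl⟩ := hz
    have h := Submodule.smul_mem_smul (I := Ideal.span (Set.range f))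
      (Ideal.subset_span (Set.mem_range_self i))
      (Submodule.mem_top : (1 : MvPolynomial ι F) ∈ (⊤ : Submodule A _))
    rwa [Algebra.smul_def, mul_one] at h
  | zero => exact Submodule.zero_mem _
  | add z w _ _ hz hw => exact Submodule.add_mem _ hz hw
  | smul r z _ hz =>
    refine Submodule.smul_induction_on hz (fun c hc w _ => ?_) fun w w' hw hw' => ?_
    · rw [smul_comm]
      exact Submodule.smul_mem_smul hc trivial
    · rw [smul_add]
      exact Submodule.add_mem _ hw hw'

/-- On the solutions of the system `∏ j, (x j - a i j) = b i`, where no column of `a` has a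
repeated entry, each coordinate takes at most `(Fintype.card ι)!` values. -/
theorem card_image_le_factorial_of_prod_sub_eq [DecidableEq F]
    (hcard : Fintype.card κ = Fintype.card ι)
    (a : κ → ι → F) (ha : ∀ j, Function.Injective fun i => a i j)
    (b : κ → F) (Z : Finset (ι → F))
    (hZ : ∀ x ∈ Z, ∀ i, ∏ j, (x j - a i j) = b i) (k : ι) :
    (Z.image fun x => x k).card ≤ (Fintype.card ι).factorial := by
  obtain rfl | ⟨x₀, hx₀⟩ := Z.eq_empty_or_nonempty
  · simp
  let A := translateAlgebra a
  have := isIntegral_translateAlgebra hcard a ha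
  let ev (x : ι → F) : A →ₐ[F] F := (MvPolynomial.aeval x).comp A.val
  have hev (x) (hx : x ∈ Z) : ev x = ev x₀ := by
    refine AlgHom.adjoin_ext ?_
    rintro _ ⟨i, rfl⟩
    have h (y) (hy : y ∈ Z)  : MvPolynomial.aeval y (translateProd (a i)) = b i := by
      simpa [translateProd, map_prod] using hZ y hy i
    exact (h x hx).trans (h x₀ hx₀).symm
  have hmonic : (minpoly A (X k : MvPolynomial ι F)).Monic :=
    minpoly.monic (Algebra.IsIntegral.isIntegral _)
  set P : F[X] := (minpoly A (X k : MvPolynomial ι F)).map (ev x₀).toRingHom with hP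
  have hP0 : P ≠ 0 := (hmonic.map _).ne_zero
  have hroots : Z.image (fun x => x k) ⊆ P.roots.toFinset := by
    intro y hy
    obtain ⟨x, hx, rfl⟩ := Finset.mem_image.mp hy
    rw [Multiset.mem_toFinset, Polynomial.mem_roots hP0, Polynomial.IsRoot, hP, ← hev x hx,
      Polynomial.eval_map]
    have h := congrArg (MvPolynomial.eval x) (minpoly.aeval A (X k : MvPolynomial ι F))
    rw [Polynomial.aeval_def, Polynomial.hom_eval₂, MvPolynomial.eval_X, map_zero] at h
    exact h
  calc (Z.image fun x => x k).card ≤ P.roots.toFinset.card := Finset.card_le_card hroots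
    _ ≤ P.natDegree := (Multiset.toFinset_card_le _).trans P.card_roots'
    _ ≤ (minpoly A (X k : MvPolynomial ι F)).natDegree := Polynomial.natDegree_map_le
    _ ≤ _ := natDegree_minpoly_translateAlgebra_le hcard a ha _

end TranslateProd

/-- For distinct elements `B i`, as many as the degree of the extension `L/K`, a system of norm
equations `N(y + B i) = c i` has at most `[L : K]!` solutions. -/
theorem card_le_factorial_of_norm_add_eq {K L κ : Type*} [Field K] [Finite K] [Field L] [Finite L]
    [Algebra K L] [Fintype κ] (hcard : Fintype.card κ = Module.finrank K L) (B : κ → L)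
    (hB : Function.Injective B) (c : κ → K) (Y : Finset L)
    (hY : ∀ y ∈ Y, ∀ i, Algebra.norm K (y + B i) = c i) :
    Y.card ≤ (Module.finrank K L).factorial := by
  classical
  have hGal : Fintype.card Gal(L/K) = Module.finrank K L := by
    rw [← Nat.card_eq_fintype_card, IsGalois.card_aut_eq_finrank]
  have h := card_image_le_factorial_of_prod_sub_eq (hcard.trans hGal.symm)
    (fun i (σ : Gal(L/K)) => -σ (B i)) (fun σ i i' hii' => hB (σ.injective (neg_injective hii')))
    (fun i => algebraMap K L (c i)) (Y.image fun y (σ : Gal(L/K)) => σ y) ?_ 1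
  · rw [Finset.image_image, hGal] at h
    simpa [Function.comp_def] using h
  · intro x hx i
    obtain ⟨y, hy, rfl⟩ := Finset.mem_image.mp hx
    simp only [sub_neg_eq_add, ← map_add]
    rw [← Algebra.norm_eq_prod_automorphisms, hY y hy i]

theorem norm_add_eq_of_projNormGraph_adj {K L : Type} [Field K] [Field L] [Algebra K L]
    {v w : L × Kˣ} (h : (projNormGraph K L).Adj v w) :
    Algebra.norm K (w.1 + v.1) = (v.2 : K) * (w.2 : K) := by
  rw [projNormGraph, SimpleGraph.fromRel_adj] at h
  rcases h.2 with h | h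
  · rw [add_comm, h]
  · rw [h, mul_comm]

/-- In the projective norm graph `P(q, t)` — realized here on `L × Kˣ`, where `K` is a
finite field (of order `q`) and `L/K` is a field extension of degree `t - 1` — any `t`
distinct vertices have at most `(t-1)!` common neighbours. -/
theorem common_neighbours_bound (K L : Type) [Field K] [Fintype K] [Field L] [Fintype L]
    [Algebra K L] (t : ℕ) (ht : 3 ≤ t) (hrank : Module.finrank K L = t - 1)
    (S : Finset (L × Kˣ)) (hS : S.card = t) :
    {v : L × Kˣ | ∀ s ∈ S, (projNormGraph K L).Adj s v}.ncard ≤ (t - 1).factorial := by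
  classical
  set V := {v : L × Kˣ | ∀ s ∈ S, (projNormGraph K L).Adj s v}
  have hnorm (v) (hv : v ∈ V) (s) (hs : s ∈ S) :
      Algebra.norm K (v.1 + s.1) = (s.2 : K) * (v.2 : K) :=
    norm_add_eq_of_projNormGraph_adj (hv s hs)
  have hne (v) (hv : v ∈ V) (s) (hs : s ∈ S) : v.1 + s.1 ≠ 0 := by
    intro h0
    have h := hnorm v hv s hs
    rw [h0, Algebra.norm_zero] at h
    exact mul_ne_zero s.2.ne_zero v.2.ne_zero h.symm
  obtain hempty | ⟨v₀, hv₀⟩ := V.eq_empty_or_nonempty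
  · simp [hempty]
  have hfst (s) (hs : s ∈ S) (s') (hs' : s' ∈ S) (h : s.1 = s'.1) : s = s' := by
    refine Prod.ext h (Units.ext (mul_right_cancel₀ v₀.2.ne_zero ?_))
    rw [← hnorm v₀ hv₀ s hs, ← hnorm v₀ hv₀ s' hs', h]
  obtain ⟨s₀, hs₀⟩ : S.Nonempty := Finset.card_pos.mp (by omega)
  have hsub (s : S.erase s₀) : s.1.1 - s₀.1 ≠ 0 := fun h =>
    (Finset.mem_erase.mp s.2).1 (hfst _ (Finset.mem_of_mem_erase s.2) _ hs₀ (sub_eq_zero.mp h))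
  have hinj : Set.InjOn (fun v : L × Kˣ => (v.1 + s₀.1)⁻¹) V := by
    intro v hv w hw hvw
    have h : v.1 = w.1 := add_right_cancel (inv_injective hvw)
    refine Prod.ext h (Units.ext (mul_left_cancel₀ s₀.2.ne_zero ?_))
    rw [← hnorm v hv s₀ hs₀, ← hnorm w hw s₀ hs₀, h]
  rw [← hinj.ncard_image, Set.ncard_eq_toFinset_card', ← hrank]
  refine card_le_factorial_of_norm_add_eq (κ := S.erase s₀) ?_ (fun s => (s.1.1 - s₀.1)⁻¹) ?_
    (fun s => (s.1.2 : K) / s₀.2 / Algebra.norm K (s.1.1 - s₀.1)) _ ?_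
  · rw [Fintype.card_coe, Finset.card_erase_of_mem hs₀, hS, hrank]
  · intro s s' h
    exact Subtype.ext (hfst _ (Finset.mem_of_mem_erase s.2) _ (Finset.mem_of_mem_erase s'.2)
      (sub_left_injective (inv_injective h)))
  · intro y hy s
    obtain ⟨v, hv, rfl⟩ := Set.mem_toFinset.mp hy
    have hv₀ := hne v hv s₀ hs₀
    have hs := hsub s
    have h : ((v.1 + s₀.1)⁻¹ + (s.1.1 - s₀.1)⁻¹) * (s.1.1 - s₀.1) * (v.1 + s₀.1) =
        v.1 + s.1.1 := by
      field_simp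
      ring
    have hN := congrArg (Algebra.norm K) h
    rw [map_mul, map_mul, hnorm v hv s₀ hs₀, hnorm v hv s (Finset.mem_of_mem_erase s.2),
      ← mul_assoc] at hN
    exact eq_div_of_mul_eq (Algebra.norm_ne_zero_iff.mpr hs)
      (eq_div_of_mul_eq s₀.2.ne_zero (mul_right_cancel₀ v.2.ne_zero hN))
end

section
/- Let ζ be a primitive third root of unity in ℂ and let F = ℚ(ζ, ∛2, ∛3) ⊆ ℂ. Then F is a Galois extension of ℚ of degree [F : ℚ] = 18. -/
open Polynomial IntermediateField

theorem IntermediateField.finrank_adjoin_simple_of_irreducible {K L : Type*} [Field K] [Field L]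
    [Algebra K L] {x : L} {p : K[X]} (hp : Irreducible p) (hx : aeval x p = 0) :
    Module.finrank K K⟮x⟯ = p.natDegree := by
  rw [adjoin.finrank (isAlgebraic_iff_isIntegral.mp ⟨p, hp.ne_zero, hx⟩),
    ← minpoly.eq_of_irreducible hp hx, natDegree_mul_leadingCoeff_inv p hp.ne_zero]

/-- Adjoining a root of an irreducible polynomial multiplies the degree by that of the
polynomial. -/
theorem IntermediateField.finrank_adjoin_union_singleton {F E : Type*} [Field F] [Field E]
    [Algebra F E] (S : Set E) {x : E} {p : (adjoin F S)[X]} (hp : Irreducible p)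
    (hx : aeval x p = 0) :
    Module.finrank F (adjoin F (S ∪ {x})) = Module.finrank F (adjoin F S) * p.natDegree := by
  rw [← adjoin_adjoin_left, ← finrank_adjoin_simple_of_irreducible hp hx]
  exact (Module.finrank_mul_finrank F (adjoin F S) (adjoin F S)⟮x⟯).symm

/-- If `a` is not a cube in `K` and `b` is a cube in `K(∛a)`, then `b` is, up to a cube in `K`,
one of `1`, `a`, `a²`. -/
theorem exists_eq_mul_cube_of_mem_adjoin {K L : Type*} [Field K] [Field L] [Algebra K L]
    (h3 : (3 : K) ≠ 0) {a b : K} (ha : ∀ r : K, r ^ 3 ≠ a) {x y : L}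
    (hx : x ^ 3 = algebraMap K L a) (hyx : y ∈ K⟮x⟯) (hy : y ^ 3 = algebraMap K L b) :
    ∃ r : K, b = r ^ 3 ∨ b = a * r ^ 3 ∨ b = a ^ 2 * r ^ 3 := by
  have hirr : Irreducible (X ^ 3 - C a) :=
    (X_pow_sub_C_irreducible_iff_of_prime Nat.prime_three).mpr ha
  have hmonic : (X ^ 3 - C a).Monic := monic_X_pow_sub_C a (by norm_num)
  have hroot : aeval x (X ^ 3 - C a) = 0 := by simp [hx]
  have hmin : minpoly K x = X ^ 3 - C a :=
    (minpoly.eq_of_irreducible_of_monic hirr hroot hmonic).symm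
  have hint : IsIntegral K x := ⟨_, hmonic, hroot⟩
  have indep (u v w : K)
      (h : algebraMap K L u + algebraMap K L v * x + algebraMap K L w * x ^ 2 = 0) :
      u = 0 ∧ v = 0 ∧ w = 0 := by
    have h0 : C w * X ^ 2 + C v * X + C u = 0 := by
      refine eq_zero_of_dvd_of_natDegree_lt (p := minpoly K x) (minpoly.dvd K x ?_) ?_
      · simp only [map_add, map_mul, map_pow, aeval_X, aeval_C]
        linear_combination h
      · rw [hmin, natDegree_X_pow_sub_C]
        exact natDegree_quadratic_le.trans_lt (by norm_num)
    refine ⟨?_, ?_, ?_⟩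
    · simpa using congrArg (coeff · 0) h0
    · simpa [coeff_X, coeff_C] using congrArg (coeff · 1) h0
    · simpa [coeff_X, coeff_C] using congrArg (coeff · 2) h0
  obtain ⟨u, v, w, rfl⟩ : ∃ u v w : K,
      y = algebraMap K L u + algebraMap K L v * x + algebraMap K L w * x ^ 2 := by
    rw [← mem_toSubalgebra, adjoin_simple_toSubalgebra_of_isAlgebraic hint.isAlgebraic,
      Algebra.adjoin_singleton_eq_range_aeval] at hyx
    obtain ⟨p, rfl⟩ := hyx
    refine ⟨(p %ₘ (X ^ 3 - C a)).coeff 0, (p %ₘ (X ^ 3 - C a)).coeff 1,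
      (p %ₘ (X ^ 3 - C a)).coeff 2, ?_⟩
    have hdeg : (p %ₘ (X ^ 3 - C a)).natDegree < 3 := by
      simpa using natDegree_modByMonic_lt p hmonic (by
        intro h
        simpa using congrArg natDegree h)
    have := aeval_modByMonic_eq_self_of_root (p := p) hroot
    rw [AlgHom.toRingHom_eq_coe, RingHom.coe_coe, ← this, aeval_eq_sum_range' hdeg]
    simp [Finset.sum_range_succ, Algebra.smul_def]
  obtain ⟨h0, h1, h2⟩ := indep (u ^ 3 + a * v ^ 3 + a ^ 2 * w ^ 3 + 6 * a * u * v * w - b)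
    (3 * (u ^ 2 * v + a * u * w ^ 2 + a * v ^ 2 * w))
    (3 * (u ^ 2 * w + u * v ^ 2 + a * v * w ^ 2)) (by
      simp only [map_sub, map_add, map_mul, map_pow, map_ofNat, ← hy, ← hx]
      ring)
  replace h1 := (mul_eq_zero.mp h1).resolve_left h3
  replace h2 := (mul_eq_zero.mp h2).resolve_left h3
  have ha0 : a ≠ 0 := fun h ↦ ha 0 (by simp [h])
  have huvw : u * (a * w ^ 3 - v ^ 3) = 0 := by linear_combination w * h1 - v * h2
  rcases mul_eq_zero.mp huvw with rfl | h
  · have hvw : v = 0 ∨ w = 0 := by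
      simpa [ha0] using h1
    rcases hvw with rfl | rfl
    · exact ⟨w, .inr (.inr (by linear_combination -h0))⟩
    · exact ⟨v, .inr (.inl (by linear_combination -h0))⟩
  · have hw : w = 0 := by
      by_contra hw
      refine ha (v / w) ?_
      field_simp
      linear_combination -h
    subst hw
    have hv : v = 0 := by simpa using h
    subst hv
    exact ⟨u, .inl (by linear_combination -h0)⟩

theorem Rat.pow_ne_of_not_dvd_padicValRat (p : ℕ) [Fact p.Prime] {n : ℕ} {q : ℚ}
    (h : ¬ (n : ℤ) ∣ padicValRat p q) (r : ℚ) : r ^ n ≠ q := by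
  rintro rfl
  exact h (by simp [padicValRat.pow])

theorem Normal.isGalois {K L : Type*} [Field K] [PerfectField K] [Field L] [Algebra K L]
    (h : Normal K L) : IsGalois K L :=
  have : Algebra.IsAlgebraic K L := h.toIsAlgebraic
  IsGalois.mk

/-- Adjoining an `n`-th root of an element of `K` along with a primitive `n`-th root of unity
gives a normal extension of `K`. -/
theorem IsPrimitiveRoot.normal_adjoin_pair {K L : Type*} [Field K] [Field L] [Algebra K L]
    {n : ℕ} [NeZero n] {ζ : L} (hζ : IsPrimitiveRoot ζ n) {a : K} {x : L} (hx0 : x ≠ 0)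
    (hx : x ^ n = algebraMap K L a) : Normal K (adjoin K {ζ, x}) := by
  have hn : 0 < n := Nat.pos_of_neZero n
  have hmem (y : L) : y ∈ (X ^ n - C a : K[X]).rootSet L ↔ y ^ n = algebraMap K L a := by
    rw [mem_rootSet_of_ne (X_pow_sub_C_ne_zero hn a)]
    simp [sub_eq_zero]
  have hsplits : ((X ^ n - C a : K[X]).map (algebraMap K L)).Splits := by
    simpa using X_pow_sub_C_splits_of_isPrimitiveRoot hζ hx
  have hadj : adjoin K {ζ, x} = adjoin K ((X ^ n - C a : K[X]).rootSet L) := by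
    apply le_antisymm
    · rw [adjoin_le_iff, Set.pair_subset_iff]
      have hxm := subset_adjoin K _ ((hmem x).mpr hx)
      refine ⟨?_, hxm⟩
      have hζx := subset_adjoin K _ ((hmem (ζ * x)).mpr (by
        rw [mul_pow, hζ.pow_eq_one, hx, one_mul]))
      simpa [hx0] using div_mem hζx hxm
    · rw [adjoin_le_iff]
      intro y hy
      rw [hmem] at hy
      obtain ⟨i, -, hi⟩ := hζ.eq_pow_of_pow_eq_one (ξ := y / x) (by
        rw [div_pow, hy, ← hx, div_self (pow_ne_zero n hx0)])
      rw [← (eq_div_iff hx0).mp hi]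
      exact mul_mem (pow_mem (subset_adjoin K _ (by simp)) i) (subset_adjoin K _ (by simp))
  rw [hadj]
  have := adjoin_rootSet_isSplittingField hsplits
  exact Normal.of_isSplittingField (X ^ n - C a)

theorem Complex.adjoin_ofReal_le_range (S : Set ℝ) :
    adjoin ℚ (Complex.ofReal '' S) ≤ (Complex.ofRealAm.restrictScalars ℚ).fieldRange := by
  rw [adjoin_le_iff]
  rintro _ ⟨r, -, rfl⟩
  exact ⟨r, rfl⟩

/-- A real field does not contain primitive cube roots of unity. -/
theorem Complex.irreducible_cyclotomic_three_of_le_range {K : IntermediateField ℚ ℂ}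
    (hK : K ≤ (Complex.ofRealAm.restrictScalars ℚ).fieldRange) :
    Irreducible (cyclotomic 3 K) := by
  have hdeg : (cyclotomic 3 K).natDegree = 2 := by
    rw [natDegree_cyclotomic]; decide
  rw [irreducible_iff_roots_eq_zero_of_degree_le_three (by rw [hdeg]) (by rw [hdeg]; norm_num)]
  refine Multiset.eq_zero_of_forall_notMem fun w hw ↦ ?_
  obtain ⟨r, hr⟩ := hK w.2
  have h := (mem_roots'.mp hw).2
  rw [cyclotomic_three, IsRoot.def] at h
  have hw0 : (w : ℂ) ^ 2 + w + 1 = 0 := by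
    simpa using congrArg (algebraMap K ℂ) h
  have hr0 : r ^ 2 + r + 1 = 0 := by
    rw [← hr] at hw0
    change (r : ℂ) ^ 2 + r + 1 = 0 at hw0
    exact_mod_cast hw0
  nlinarith [sq_nonneg (r + 1 / 2)]

/-- `F = ℚ(ζ, ∛2, ∛3) ⊆ ℂ`, where `ζ` is a primitive third root of unity and `∛2, ∛3`
are the real cube roots of `2` and `3`, is a Galois extension of `ℚ` of degree `18`. -/
theorem F_galois_degree_18 (ζ : ℂ) (hζ : IsPrimitiveRoot ζ 3)
    (F : IntermediateField ℚ ℂ)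
    (hF : F = IntermediateField.adjoin ℚ
      {ζ, (((2 : ℝ) ^ ((1 : ℝ) / 3) : ℝ) : ℂ), (((3 : ℝ) ^ ((1 : ℝ) / 3) : ℝ) : ℂ)}) :
    IsGalois ℚ F ∧ Module.finrank ℚ F = 18 := by
  have cube_root (t : ℝ) (ht : 0 ≤ t) : (((t ^ ((1 : ℝ) / 3) : ℝ) : ℂ)) ^ 3 = t := by
    rw [← Complex.ofReal_pow, ← Real.rpow_natCast, ← Real.rpow_mul ht]
    norm_num
  have hα : (((2 : ℝ) ^ ((1 : ℝ) / 3) : ℝ) : ℂ) ^ 3 = algebraMap ℚ ℂ 2 := by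
    simpa using cube_root 2 zero_le_two
  have hβ : (((3 : ℝ) ^ ((1 : ℝ) / 3) : ℝ) : ℂ) ^ 3 = algebraMap ℚ ℂ 3 := by
    simpa using cube_root 3 zero_le_three
  have hreal := Complex.adjoin_ofReal_le_range {(2 : ℝ) ^ ((1 : ℝ) / 3), (3 : ℝ) ^ ((1 : ℝ) / 3)}
  rw [Set.image_pair] at hreal
  generalize (((2 : ℝ) ^ ((1 : ℝ) / 3) : ℝ) : ℂ) = α at *
  generalize (((3 : ℝ) ^ ((1 : ℝ) / 3) : ℝ) : ℂ) = β at *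
  subst hF
  constructor
  · have hα0 : α ≠ 0 := by rintro rfl; norm_num at hα
    have hβ0 : β ≠ 0 := by rintro rfl; norm_num at hβ
    have hsup : adjoin ℚ {ζ, α, β} = adjoin ℚ {ζ, α} ⊔ adjoin ℚ {ζ, β} := by
      rw [← adjoin_union]
      congr 1
      ext
      simp
      tauto
    have := hζ.normal_adjoin_pair hα0 hα
    have := hζ.normal_adjoin_pair hβ0 hβ
    rw [hsup]
    exact (normal_sup ℚ ℂ (adjoin ℚ {ζ, α}) (adjoin ℚ {ζ, β})).isGalois
  · have two_not_cube : ∀ r : ℚ, r ^ 3 ≠ 2 := Rat.pow_ne_of_not_dvd_padicValRat 2 (by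
      rw [show padicValRat 2 2 = 1 from padicValRat.self one_lt_two]
      norm_num)
    have three_not_cube_mul (c : ℚ) (hc0 : c ≠ 0) (hc : padicValRat 3 c = 0) (r : ℚ) :
        3 ≠ c * r ^ 3 := by
      refine fun h ↦ Rat.pow_ne_of_not_dvd_padicValRat 3 (n := 3) (q := 3 / c) ?_ r ?_
      · rw [padicValRat.div three_ne_zero hc0, hc,
          show padicValRat 3 3 = 1 from padicValRat.self (by norm_num)]
        norm_num
      · rw [h]
        field_simp
    have v2 : padicValRat 3 2 = 0 := by
      exact_mod_cast padicValNat.eq_zero_of_not_dvd (p := 3) (n := 2) (by norm_num)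
    have hα_irr : Irreducible (X ^ 3 - C 2 : ℚ[X]) :=
      (X_pow_sub_C_irreducible_iff_of_prime Nat.prime_three).mpr two_not_cube
    have coe_three : ((3 : ℚ⟮α⟯) : ℂ) = 3 := rfl
    have hβ_irr : Irreducible (X ^ 3 - C 3 : ℚ⟮α⟯[X]) := by
      refine (X_pow_sub_C_irreducible_iff_of_prime Nat.prime_three).mpr fun y hy ↦ ?_
      obtain ⟨r, h | h | h⟩ := exists_eq_mul_cube_of_mem_adjoin three_ne_zero two_not_cube hα y.2
        (b := 3) (by simpa [coe_three] using congrArg (algebraMap ℚ⟮α⟯ ℂ) hy)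
      · exact three_not_cube_mul 1 one_ne_zero (by simp) r (by simpa using h)
      · exact three_not_cube_mul 2 two_ne_zero v2 r h
      · exact three_not_cube_mul (2 ^ 2) (by norm_num)
          (by rw [padicValRat.pow, v2, mul_zero]) r h
    have hα_deg : Module.finrank ℚ ℚ⟮α⟯ = 3 := by
      rw [finrank_adjoin_simple_of_irreducible hα_irr (by simp [hα]), natDegree_X_pow_sub_C]
    have hαβ_deg : Module.finrank ℚ (adjoin ℚ {α, β}) = 9 := by
      have h := finrank_adjoin_union_singleton {α} hβ_irr (x := β) (by
        simpa [sub_eq_zero, coe_three] using hβ)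
      rwa [hα_deg, natDegree_X_pow_sub_C, Set.singleton_union] at h
    have h := finrank_adjoin_union_singleton {α, β}
      (Complex.irreducible_cyclotomic_three_of_le_range hreal) (x := ζ) (by
        simpa [aeval_def, eval₂_eq_eval_map] using hζ.isRoot_cyclotomic (by norm_num))
    rw [hαβ_deg, natDegree_cyclotomic, Nat.totient_prime Nat.prime_three,
      Set.union_singleton] at h
    exact h
end

section
/- Let ζ be a primitive third root of unity in ℂ and let u = 6^{1/3} be the real cube root of 6. Then the three complex numbers −4u − 2u² − 7, −4uζ − 2u²ζ̄ − 7, and −4uζ̄ − 2u²ζ − 7 (where ζ̄ = ζ² is the complex conjugate of ζ) are exactly the three roots of the polynomial g(x) = x³ + 21x² + 3x + 7; in particular g splits completely over the field ℚ(ζ, 6^{1/3}). -/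
open Polynomial

/-- Vieta's formulas determine the roots of a monic cubic. -/
theorem roots_cubic_of_vieta {R : Type*} [CommRing R] [IsDomain R] {p q r a b c : R}
    (h₁ : a + b + c = -p) (h₂ : a * b + a * c + b * c = q) (h₃ : a * b * c = -r) :
    (X ^ 3 + C p * X ^ 2 + C q * X + C r : R[X]).roots = {a, b, c} := by
  obtain rfl : p = -(a + b + c) := by rw [h₁, neg_neg]
  obtain rfl : r = -(a * b * c) := by rw [h₃, neg_neg]
  subst h₂
  rw [← roots_multiset_prod_X_sub_C ({a, b, c} : Multiset R)]
  congr 1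
  simp only [Multiset.insert_eq_cons, Multiset.map_cons, Multiset.map_singleton,
    Multiset.prod_cons, Multiset.prod_singleton, map_neg, map_add, map_mul]
  ring

/-- With `u = 6^{1/3}` the real cube root of `6` and `ζ` a primitive third root of
unity in `ℂ` (so `ζ̄ = ζ²`), the numbers `-4u - 2u² - 7`, `-4uζ - 2u²ζ² - 7` and
`-4uζ² - 2u²ζ - 7` are exactly the three roots of `g(x) = x³ + 21x² + 3x + 7`; in
particular all the roots of `g` lie in (so `g` splits completely over) the field
`ℚ(ζ, 6^{1/3})`. -/
theorem roots_of_g (ζ : ℂ) (hζ : IsPrimitiveRoot ζ 3)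
    (u : ℂ) (hu : u = (((6 : ℝ) ^ ((1 : ℝ) / 3) : ℝ) : ℂ)) :
    (X ^ 3 + 21 * X ^ 2 + 3 * X + 7 : ℂ[X]).roots =
      {-4 * u - 2 * u ^ 2 - 7, -4 * u * ζ - 2 * u ^ 2 * ζ ^ 2 - 7,
        -4 * u * ζ ^ 2 - 2 * u ^ 2 * ζ - 7} ∧
    ∀ x ∈ (X ^ 3 + 21 * X ^ 2 + 3 * X + 7 : ℂ[X]).roots,
      x ∈ IntermediateField.adjoin ℚ {ζ, u} := by
  have hu3 : u ^ 3 = 6 := by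
    rw [hu, ← Complex.ofReal_pow, ← Real.rpow_natCast, ← Real.rpow_mul (by norm_num)]
    norm_num
  have hζ2 : ζ ^ 2 + ζ + 1 = 0 := by
    have h := hζ.geom_sum_eq_zero (by norm_num)
    simp only [Finset.sum_range_succ, Finset.sum_range_zero] at h
    linear_combination h
  have hroots : (X ^ 3 + 21 * X ^ 2 + 3 * X + 7 : ℂ[X]).roots =
      {-4 * u - 2 * u ^ 2 - 7, -4 * u * ζ - 2 * u ^ 2 * ζ ^ 2 - 7,
        -4 * u * ζ ^ 2 - 2 * u ^ 2 * ζ - 7} := by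
    have hζ' : ζ ^ 2 = -ζ - 1 := by linear_combination hζ2
    rw [hζ']
    refine roots_cubic_of_vieta (p := 21) (q := 3) (r := 7) ?_ ?_ ?_
    · ring
    · grind
    · grind
  refine ⟨hroots, fun x hx => ?_⟩
  have hζK : ζ ∈ IntermediateField.adjoin ℚ {ζ, u} :=
    IntermediateField.subset_adjoin _ _ (by simp)
  have huK : u ∈ IntermediateField.adjoin ℚ {ζ, u} :=
    IntermediateField.subset_adjoin _ _ (by simp)
  have mem (a b : ℂ) (ha : a ∈ IntermediateField.adjoin ℚ {ζ, u})
      (hb : b ∈ IntermediateField.adjoin ℚ {ζ, u}) :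
      -4 * u * a - 2 * u ^ 2 * b - 7 ∈ IntermediateField.adjoin ℚ {ζ, u} :=
    sub_mem (sub_mem (mul_mem (mul_mem (neg_mem (ofNat_mem _ 4)) huK) ha)
      (mul_mem (mul_mem (ofNat_mem _ 2) (pow_mem huK 2)) hb)) (ofNat_mem _ 7)
  rw [hroots] at hx
  simp only [Multiset.insert_eq_cons, Multiset.mem_cons, Multiset.mem_singleton] at hx
  rcases hx with rfl | rfl | rfl
  · simpa using mem 1 1 (one_mem _) (one_mem _)
  · exact mem _ _ hζK (pow_mem hζK 2)
  · exact mem _ _ (pow_mem hζK 2) hζK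
end

section
/- Let K be a field of characteristic zero, let t ≥ 4 be an integer, and let θ ∈ K. Then the Galois group over the rational function field K(T) of the polynomial x^{t−1} − x + θ − T is isomorphic to the full symmetric group S_{t−1} on t−1 letters. -/
open Polynomial

theorem MonoidHom.surjective_of_isSwap_of_two_transitive {G α : Type*} [Group G] [Finite α]
    [DecidableEq α] (φ : G →* Equiv.Perm α) {g : G} (hg : (φ g).IsSwap)
    (h : ∀ a b c d : α, a ≠ b → c ≠ d → ∃ σ : G, φ σ a = c ∧ φ σ b = d) :
    Function.Surjective φ := by
  rw [← MonoidHom.range_eq_top, ← top_le_iff, ← Equiv.Perm.closure_isSwap,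
    Subgroup.closure_le]
  rintro _ ⟨c, d, hcd, rfl⟩
  obtain ⟨a, b, hab, hg⟩ := hg
  obtain ⟨σ, rfl, rfl⟩ := h a b c d hab hcd
  exact ⟨σ * g * σ⁻¹, by
    rw [map_mul, map_mul, hg, map_inv, Equiv.mul_swap_eq_swap_mul, mul_inv_cancel_right]⟩

theorem Polynomial.Gal.exists_isSwap_of_card_roots {F E₀ : Type*} [Field F] [Field E₀]
    [Algebra F E₀] (p : F[X]) (hp : p.Separable)
    (hroots : p.natDegree ≤ (p.rootSet E₀).ncard + 2)
    (hsplit : ¬ (p.map (algebraMap F E₀)).Splits) (E : Type*) [Field E] [Algebra F E]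
    [Algebra E₀ E] [IsScalarTower F E₀ E] [IsSplittingField E₀ E (p.map (algebraMap F E₀))]
    [Fact (p.map (algebraMap F E)).Splits] [DecidableEq (p.rootSet E)] :
    ∃ g : p.Gal, (galActionHom p E g).IsSwap := by
  have hsplitE : (p.map (algebraMap F E)).Splits := Fact.out
  have hp0 : p ≠ 0 := hp.ne_zero
  have : IsGalois E₀ E := IsGalois.of_separable_splitting_field (p := p.map (algebraMap F E₀)) hp.map
  have : FiniteDimensional E₀ E :=
    IsSplittingField.finiteDimensional E (p.map (algebraMap F E₀))
  obtain ⟨x, hx, hxr⟩ : ∃ x ∈ p.rootSet E, x ∉ (algebraMap E₀ E).range := by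
    by_contra! h
    apply hsplit
    refine Splits.of_splits_map (f := p.map (algebraMap F E₀)) (algebraMap E₀ E) ?_ ?_
    · rwa [Polynomial.map_map, ← IsScalarTower.algebraMap_eq]
    · intro a ha
      rw [Polynomial.map_map, ← IsScalarTower.algebraMap_eq] at ha
      exact h a (mem_rootSet.mpr (by simpa using ha))
  obtain ⟨σ, hσ⟩ : ∃ σ : Gal(E/E₀), σ x ≠ x := by
    by_contra! h
    exact hxr ((IsGalois.mem_bot_iff_fixed x).mpr h)
  refine ⟨restrict p E (σ.restrictScalars F), ?_⟩
  set τ := galActionHom p E (restrict p E (σ.restrictScalars F)) with hτ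
  have hτσ (y : p.rootSet E) : (τ y : E) = σ y := galActionHom_restrict p E _ y
  rw [← Equiv.Perm.card_support_eq_two]
  have hne : τ ≠ 1 := by
    intro h
    apply hσ
    rw [← hτσ ⟨x, hx⟩, h]
    rfl
  have hge := Equiv.Perm.one_lt_card_support_of_ne_one hne
  have himg : algebraMap E₀ E '' p.rootSet E₀ ⊆ p.rootSet E := by
    rintro _ ⟨y, hy, rfl⟩
    rw [mem_rootSet] at hy ⊢
    exact ⟨hp0, by rw [aeval_algebraMap_apply, hy.2, map_zero]⟩
  have hfix : algebraMap E₀ E '' p.rootSet E₀ ⊆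
      (Subtype.val '' (τ.support : Set (p.rootSet E)))ᶜ := by
    rintro _ ⟨y, hy, rfl⟩ ⟨z, hz, hzy⟩
    rw [Finset.mem_coe, Equiv.Perm.mem_support] at hz
    apply hz
    ext
    rw [hτσ, hzy, AlgEquiv.commutes]
  have hdisj := Set.disjoint_of_subset_left hfix disjoint_compl_left
  have hunion : algebraMap E₀ E '' p.rootSet E₀ ∪ Subtype.val '' (τ.support : Set (p.rootSet E))
      ⊆ p.rootSet E := by
    refine Set.union_subset himg ?_
    rintro _ ⟨z, -, rfl⟩
    exact z.2
  have hcard := Set.ncard_le_ncard hunion (rootSet_finite p E)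
  rw [Set.ncard_union_eq hdisj ((rootSet_finite p E₀).image _) (Set.toFinite _),
    Set.ncard_image_of_injective _ (algebraMap E₀ E).injective,
    Set.ncard_image_of_injective _ Subtype.val_injective, Set.ncard_coe_finset] at hcard
  have : (p.rootSet E).ncard = p.natDegree := by
    rw [← card_rootSet_eq_natDegree hp hsplitE, Set.ncard_eq_toFinset_card', Set.toFinset_card]
  omega

theorem exists_algEquiv_of_irreducible {F L M : Type*} [Field F] [Field L] [Field M] [Algebra F L]
    [Normal F L] (φ : M →+* L) (hφ : (algebraMap F L).range ≤ φ.range) {q : M[X]}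
    (hq : Irreducible q) {x y : L} (hx : q.eval₂ φ x = 0) (hy : q.eval₂ φ y = 0) :
    ∃ σ : Gal(L/F), σ x = y ∧ ∀ m, σ (φ m) = φ m := by
  let E : IntermediateField F L := φ.fieldRange.toIntermediateField fun a => hφ ⟨a, rfl⟩
  let ψ : M →+* E := φ.codRestrict E fun m => ⟨m, rfl⟩
  have hψ : Function.Bijective ψ :=
    ⟨ψ.injective, fun ⟨_, m, hm⟩ => ⟨m, Subtype.ext hm⟩⟩
  let e : M ≃+* E := RingEquiv.ofBijective ψ hψ
  have hq' : Irreducible (q.map (e : M →+* E)) :=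
    (MulEquiv.irreducible_iff (mapEquiv e)).mpr hq
  have key (z : L) (hz : q.eval₂ φ z = 0) : aeval z (q.map (e : M →+* E)) = 0 := by
    rw [aeval_def, eval₂_map]
    exact hz
  have : Normal E L := Normal.tower_top_of_normal F E L
  obtain ⟨σ, hσ⟩ := (Normal.minpoly_eq_iff_mem_orbit (F := E) L).mp
    ((minpoly.eq_of_irreducible hq' (key y hy)).symm.trans
      (minpoly.eq_of_irreducible hq' (key x hx)))
  exact ⟨σ.restrictScalars F, hσ, fun m => σ.commutes (ψ m)⟩

section Local

variable {k : Type*} [Field k] {n : ℕ} {c : k}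

theorem derivative_X_pow_sub_X_sub_C {R : Type*} [CommRing R] (n : ℕ) (s : R) :
    derivative (X ^ n - X - C s) = C (n : R) * X ^ (n - 1) - 1 := by
  simp [derivative_X_pow]

theorem monic_X_pow_sub_X_sub_C {R : Type*} [CommRing R] [Nontrivial R] (hn : 2 ≤ n) (s : R) :
    (X ^ n - X - C s).Monic := by
  rw [sub_sub]
  exact monic_X_pow_sub (by rw [degree_X_add_C]; exact_mod_cast hn)

theorem natDegree_X_pow_sub_X_sub_C {R : Type*} [CommRing R] [Nontrivial R] (hn : 2 ≤ n) (s : R) :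
    (X ^ n - X - C s).natDegree = n := by
  rw [sub_sub, natDegree_sub_eq_left_of_natDegree_lt, natDegree_X_pow]
  rw [natDegree_X_pow, natDegree_X_add_C]
  omega

theorem exists_powerSeries_isRoot_X_pow_sub_X_sub_C (hn : 2 ≤ n) {s d : k}
    (hd : d ^ n - d = s) (hd' : (n : k) * d ^ (n - 1) ≠ 1) :
    ∃ a : PowerSeries k, a ^ n - a = PowerSeries.C s + PowerSeries.X ∧
      PowerSeries.constantCoeff a = d := by
  obtain ⟨a, ha, had⟩ := HenselianRing.is_henselian
    (I := Ideal.span {(PowerSeries.X : PowerSeries k)})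
    (X ^ n - X - C (PowerSeries.C s + PowerSeries.X)) (monic_X_pow_sub_X_sub_C hn _)
    (PowerSeries.C d) (by
      rw [Ideal.mem_span_singleton, PowerSeries.X_dvd_iff]
      simp only [eval_sub, eval_pow, eval_X, eval_C]
      simp [hd])
    (by
      refine IsUnit.map (Ideal.Quotient.mk _) ?_
      rw [derivative_X_pow_sub_X_sub_C, PowerSeries.isUnit_iff_constantCoeff]
      simpa [sub_eq_zero] using hd')
  rw [Ideal.mem_span_singleton, PowerSeries.X_dvd_iff, map_sub, PowerSeries.constantCoeff_C,
    sub_eq_zero] at had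
  refine ⟨a, ?_, had⟩
  simpa [sub_eq_zero] using ha

theorem constantCoeff_ne_of_pow_sub_self (hc : (n : k) * c ^ (n - 1) = 1)
    {a : PowerSeries k} (ha : a ^ n - a = PowerSeries.C (c ^ n - c) + PowerSeries.X) :
    PowerSeries.constantCoeff a ≠ c := by
  intro h
  have h2 := congrArg (fun b => PowerSeries.constantCoeff (PowerSeries.derivative k b)) ha
  simp only [map_sub, map_add, Derivation.leibniz_pow] at h2
  simp only [h, nsmul_eq_mul, smul_eq_mul, map_mul, map_pow, map_natCast] at h2
  simp [← mul_assoc, hc] at h2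

theorem not_splits_X_pow_sub_X_sub_C_powerSeries (hn : 2 ≤ n) (hc : (n : k) * c ^ (n - 1) = 1) :
    ¬ (X ^ n - X - C (PowerSeries.C (c ^ n - c) + PowerSeries.X) : (PowerSeries k)[X]).Splits := by
  intro h
  have hdvd : PowerSeries.X ∣ eval (PowerSeries.C c)
      (X ^ n - X - C (PowerSeries.C (c ^ n - c) + PowerSeries.X)) := by
    rw [PowerSeries.X_dvd_iff]
    simp only [eval_sub, eval_pow, eval_X, eval_C]
    simp
  rw [h.eval_eq_prod_roots_of_monic (monic_X_pow_sub_X_sub_C hn _)] at hdvd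
  obtain ⟨a, ha, hca⟩ := PowerSeries.X_prime.exists_mem_multiset_map_dvd hdvd
  rw [PowerSeries.X_dvd_iff, map_sub, PowerSeries.constantCoeff_C, sub_eq_zero] at hca
  refine constantCoeff_ne_of_pow_sub_self hc (a := a) ?_ hca.symm
  have ha0 := (mem_roots'.mp ha).2
  rw [IsRoot.def, eval_sub, eval_sub, eval_pow, eval_X, eval_C] at ha0
  exact sub_eq_zero.mp ha0

variable {E : Type*} [Field E] [Algebra (PowerSeries k) E] [IsFractionRing (PowerSeries k) E]

theorem not_splits_map_X_pow_sub_X_sub_C (hn : 2 ≤ n) (hc : (n : k) * c ^ (n - 1) = 1) :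
    ¬ (X ^ n - X - C (algebraMap (PowerSeries k) E
      (PowerSeries.C (c ^ n - c) + PowerSeries.X)) : E[X]).Splits := by
  intro h
  apply not_splits_X_pow_sub_X_sub_C_powerSeries hn hc
  refine Splits.of_splits_map_of_injective (i := algebraMap (PowerSeries k) E)
    (FaithfulSMul.algebraMap_injective _ _) ?_ ?_
  · simpa using h
  · intro a ha
    refine IsIntegrallyClosed.isIntegral_iff.mp ⟨X ^ n - X - C (PowerSeries.C (c ^ n - c) +
      PowerSeries.X), monic_X_pow_sub_X_sub_C hn _, ?_⟩
    rw [eval₂_eq_eval_map]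
    exact (mem_roots'.mp ha).2

variable [CharZero k]

theorem eq_of_isRoot_of_isRoot_derivative (hn : 2 ≤ n) (hc : (n : k) * c ^ (n - 1) = 1) {d : k}
    (h : d ^ n - d - (c ^ n - c) = 0) (h' : (n : k) * d ^ (n - 1) - 1 = 0) : d = c := by
  obtain ⟨m, rfl⟩ : ∃ m, n = m + 2 := ⟨n - 2, by omega⟩
  have h0 : (m : k) + 1 ≠ 0 := by exact_mod_cast m.succ_ne_zero
  simp only [Nat.add_succ_sub_one] at hc h'
  push_cast at hc h'
  apply mul_left_cancel₀ h0
  linear_combination (-(m + 2 : k)) * h + d * h' - c * hc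

theorem rootMultiplicity_X_pow_sub_X_sub_C_le_one (hn : 2 ≤ n) (hc : (n : k) * c ^ (n - 1) = 1)
    {d : k} (hd : d ≠ c) : (X ^ n - X - C (c ^ n - c) : k[X]).rootMultiplicity d ≤ 1 := by
  by_contra! h
  rw [one_lt_rootMultiplicity_iff_isRoot (monic_X_pow_sub_X_sub_C hn _).ne_zero] at h
  rw [derivative_X_pow_sub_X_sub_C] at h
  exact hd (eq_of_isRoot_of_isRoot_derivative hn hc (by simpa using h.1) (by simpa using h.2))

theorem rootMultiplicity_X_pow_sub_X_sub_C_le_two (hn : 2 ≤ n) (hc : (n : k) * c ^ (n - 1) = 1) :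
    (X ^ n - X - C (c ^ n - c) : k[X]).rootMultiplicity c ≤ 2 := by
  by_contra! h
  have := isRoot_iterate_derivative_of_lt_rootMultiplicity h
  rw [Function.iterate_succ_apply, Function.iterate_one, derivative_X_pow_sub_X_sub_C] at this
  obtain ⟨m, rfl⟩ : ∃ m, n = m + 2 := ⟨n - 2, by omega⟩
  have h0 : (m : k) + 1 ≠ 0 := by exact_mod_cast m.succ_ne_zero
  have h1 : (m : k) + 2 ≠ 0 := by exact_mod_cast (m + 1).succ_ne_zero
  have hc0 : c ≠ 0 := by rintro rfl; simp at hc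
  simp [IsRoot.def, h0, h1, hc0] at this

theorem le_card_roots_X_pow_sub_X_sub_C_erase [IsAlgClosed k] [DecidableEq k] (hn : 2 ≤ n)
    (hc : (n : k) * c ^ (n - 1) = 1) :
    n ≤ ((X ^ n - X - C (c ^ n - c) : k[X]).roots.toFinset.erase c).card + 2 := by
  set f := (X ^ n - X - C (c ^ n - c) : k[X]) with hf
  have h : f.roots.card = n := by
    rw [splits_iff_card_roots.mp (IsAlgClosed.splits f), natDegree_X_pow_sub_X_sub_C hn]
  have hmem : c ∈ f.roots.toFinset := by
    rw [Multiset.mem_toFinset, mem_roots (monic_X_pow_sub_X_sub_C hn _).ne_zero]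
    simp
  rw [← Multiset.toFinset_sum_count_eq, ← Finset.sum_erase_add _ _ hmem] at h
  have h1 : ∑ x ∈ f.roots.toFinset.erase c, f.roots.count x ≤
      ∑ x ∈ f.roots.toFinset.erase c, 1 := by
    refine Finset.sum_le_sum fun x hx => ?_
    rw [count_roots]
    exact rootMultiplicity_X_pow_sub_X_sub_C_le_one hn hc (Finset.ne_of_mem_erase hx)
  have h2 : f.roots.count c ≤ 2 := by
    rw [count_roots]
    exact rootMultiplicity_X_pow_sub_X_sub_C_le_two hn hc
  simp only [Finset.sum_const, smul_eq_mul, mul_one] at h1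
  omega

theorem le_ncard_pow_sub_self_eq [IsAlgClosed k] (hn : 2 ≤ n) (hc : (n : k) * c ^ (n - 1) = 1) :
    n ≤ {x : E | x ^ n - x = algebraMap (PowerSeries k) E
      (PowerSeries.C (c ^ n - c) + PowerSeries.X)}.ncard + 2 := by
  classical
  refine (le_card_roots_X_pow_sub_X_sub_C_erase hn hc).trans (Nat.add_le_add_right ?_ 2)
  set S := (X ^ n - X - C (c ^ n - c) : k[X]).roots.toFinset.erase c
  have hS (d) (hd : d ∈ S) : ∃ a : PowerSeries k,
      a ^ n - a = PowerSeries.C (c ^ n - c) + PowerSeries.X ∧ PowerSeries.constantCoeff a = d := by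
    rw [Finset.mem_erase, Multiset.mem_toFinset,
      mem_roots (monic_X_pow_sub_X_sub_C hn _).ne_zero] at hd
    have hr : d ^ n - d - (c ^ n - c) = 0 := by simpa using hd.2
    refine exists_powerSeries_isRoot_X_pow_sub_X_sub_C hn (sub_eq_zero.mp hr) fun h => ?_
    exact hd.1 (eq_of_isRoot_of_isRoot_derivative hn hc hr (sub_eq_zero.mpr h))
  choose! a ha had using hS
  rw [← Set.ncard_coe_finset]
  refine Set.ncard_le_ncard_of_injOn (fun d => algebraMap (PowerSeries k) E (a d)) ?_ ?_ ?_
  · intro d hd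
    rw [Set.mem_ofPred_eq]
    rw [← ha d hd]
    simp
  · intro d hd d' hd' h
    rw [← had d hd, ← had d' hd', FaithfulSMul.algebraMap_injective _ _ h]
  · refine ((X ^ n - X - C (algebraMap (PowerSeries k) E
      (PowerSeries.C (c ^ n - c) + PowerSeries.X)) : E[X]).rootSet_finite E).subset ?_
    intro x hx
    rw [mem_rootSet]
    refine ⟨(monic_X_pow_sub_X_sub_C hn _).ne_zero, ?_⟩
    simpa [sub_eq_zero] using hx

end Local

section RationalFunctionField

variable {K : Type*} [Field K] {n : ℕ}

theorem natDegree_geom_sum_X {R : Type*} [CommRing R] [Nontrivial R] (hn : n ≠ 0) :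
    (∑ i ∈ Finset.range n, X ^ i : R[X]).natDegree = n - 1 := by
  have h := congrArg natDegree (geom_sum_mul (X : R[X]) n)
  rw [← C_1, (monic_geom_sum_X hn).natDegree_mul (monic_X_sub_C 1), natDegree_X_sub_C,
    natDegree_X_pow_sub_C] at h
  omega

theorem irreducible_X_pow_sub_X_add_C_ratFunc (hn : 2 ≤ n) (θ : K) :
    Irreducible (X ^ n - X + C (RatFunc.C θ - RatFunc.X) : (RatFunc K)[X]) := by
  have h : Irreducible (X ^ n - X - C (X - C θ) : K[X][X]) := by
    rw [← MulEquiv.irreducible_iff Bivariate.swap,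
      ← (Associated.refl _).neg_left.irreducible_iff]
    have : -Bivariate.swap (X ^ n - X - C (X - C θ) : K[X][X]) = X - C (X ^ n - X + C θ) := by
      simp only [map_sub, map_pow, map_add, Bivariate.swap_X, Bivariate.swap_Y,
        Bivariate.swap_C_C]
      ring
    rw [this]
    exact irreducible_X_sub_C _
  rw [(monic_X_pow_sub_X_sub_C hn _).irreducible_iff_irreducible_map_fraction_map
    (K := RatFunc K)] at h
  convert h using 1
  simp [RatFunc.algebraMap_X, RatFunc.algebraMap_C]
  ring

theorem transcendental_of_pow_sub_self {L : Type*} [Field L] [Algebra K L] [Algebra (RatFunc K) L]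
    [IsScalarTower K (RatFunc K) L] {θ : K} {a : L}
    (ha : a ^ n - a = algebraMap (RatFunc K) L (RatFunc.X - RatFunc.C θ)) :
    Transcendental K a := by
  intro h
  have hT : IsAlgebraic K (algebraMap (RatFunc K) L RatFunc.X) := by
    have : algebraMap (RatFunc K) L RatFunc.X = a ^ n - a + algebraMap K L θ := by
      rw [ha, IsScalarTower.algebraMap_apply K (RatFunc K) L, RatFunc.algebraMap_eq_C, ← map_add,
        sub_add_cancel]
    rw [this]
    exact ((h.pow n).sub h).add (isAlgebraic_algebraMap θ)
  rw [isAlgebraic_algebraMap_iff (algebraMap (RatFunc K) L).injective] at hT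
  exact RatFunc.transcendental_X hT

variable [CharZero K]

theorem irreducible_X_pow_sub_C_geom_sum (hn : 2 ≤ n) :
    Irreducible (X ^ (n - 1) - C (∑ i ∈ Finset.range n, X ^ i) : K[X][X]) := by
  have hsq : Squarefree (∑ i ∈ Finset.range n, X ^ i : K[X]) := by
    have : (X ^ n - 1 : K[X]).Separable :=
      X_pow_sub_one_separable_iff.mpr (Nat.cast_ne_zero.mpr (by omega))
    exact this.squarefree.squarefree_of_dvd ⟨X - 1, (geom_sum_mul _ _).symm⟩
  obtain ⟨π, hπ, hdvd⟩ := exists_irreducible_of_natDegree_pos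
    (f := (∑ i ∈ Finset.range n, X ^ i : K[X])) (by rw [natDegree_geom_sum_X] <;> omega)
  have hmonic := monic_X_pow_sub_C (∑ i ∈ Finset.range n, X ^ i : K[X]) (n := n - 1) (by omega)
  refine irreducible_of_eisenstein_criterion (P := Ideal.span {π})
    ((Ideal.span_singleton_prime hπ.ne_zero).mpr hπ.prime) ?_ ?_ ?_ ?_ hmonic.isPrimitive
  · rw [hmonic.leadingCoeff, Ideal.mem_span_singleton]
    exact hπ.prime.not_dvd_one
  · intro i hi
    rw [degree_X_pow_sub_C (by omega)] at hi
    have hi : i < n - 1 := by exact_mod_cast hi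
    rw [coeff_sub, coeff_X_pow, if_neg hi.ne, zero_sub, neg_mem_iff, coeff_C,
      Ideal.mem_span_singleton]
    split_ifs
    · exact hdvd
    · exact dvd_zero _
  · rw [degree_X_pow_sub_C (by omega)]
    exact_mod_cast (by omega : 0 < n - 1)
  · rw [coeff_sub, coeff_X_pow, if_neg (by omega), zero_sub, neg_mem_iff, coeff_C_zero,
      Ideal.span_singleton_pow, Ideal.mem_span_singleton, pow_two]
    exact fun h => hπ.not_isUnit (hsq π h)

theorem irreducible_geom_sum_sub_C_X_pow (hn : 2 ≤ n) :
    Irreducible (∑ i ∈ Finset.range n, X ^ i - C (RatFunc.X ^ (n - 1)) : (RatFunc K)[X]) := by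
  have h : Irreducible (∑ i ∈ Finset.range n, X ^ i - C (X ^ (n - 1)) : K[X][X]) := by
    rw [← MulEquiv.irreducible_iff Bivariate.swap,
      ← (Associated.refl _).neg_left.irreducible_iff]
    convert irreducible_X_pow_sub_C_geom_sum (K := K) hn using 1
    simp only [map_sub, map_pow, map_sum, Bivariate.swap_X, Bivariate.swap_Y]
    ring
  have hmonic : (∑ i ∈ Finset.range n, X ^ i - C (X ^ (n - 1)) : K[X][X]).Monic := by
    refine (monic_geom_sum_X (by omega)).sub_of_left ?_
    refine degree_C_le.trans_lt (natDegree_pos_iff_degree_pos.mp ?_)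
    rw [natDegree_geom_sum_X] <;> omega
  rw [hmonic.irreducible_iff_irreducible_map_fraction_map (K := RatFunc K)] at h
  convert h using 1
  simp [RatFunc.algebraMap_X, Polynomial.map_sum]

theorem exists_algEquiv_fixing_root {L : Type*} [Field L] [Algebra K L] [Algebra (RatFunc K) L]
    [IsScalarTower K (RatFunc K) L] [Normal (RatFunc K) L]
    (hn : 2 ≤ n) {θ : K} {a b d : L}
    (ha : a ^ n - a = algebraMap (RatFunc K) L (RatFunc.X - RatFunc.C θ))
    (hb : b ^ n - b = algebraMap (RatFunc K) L (RatFunc.X - RatFunc.C θ))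
    (hd : d ^ n - d = algebraMap (RatFunc K) L (RatFunc.X - RatFunc.C θ))
    (hba : b ≠ a) (hda : d ≠ a) :
    ∃ σ : Gal(L/RatFunc K), σ a = a ∧ σ b = d := by
  have hatr : Transcendental K a := transcendental_of_pow_sub_self ha
  have ha0 : a ≠ 0 := by
    rintro rfl
    exact hatr isAlgebraic_zero
  have hinj : Function.Injective (aeval (R := K) a⁻¹ : K[X] →+* L) :=
    transcendental_iff_injective.mp fun h => hatr (inv_inv a ▸ h.inv)
  let φ : RatFunc K →+* L := IsFractionRing.lift hinj
  have hφ (f : K[X]) : φ (algebraMap K[X] (RatFunc K) f) = aeval a⁻¹ f :=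
    IsFractionRing.lift_algebraMap hinj f
  have hφX : φ RatFunc.X = a⁻¹ := by rw [← RatFunc.algebraMap_X, hφ, aeval_X]
  have hφC (r : K) : φ (RatFunc.C r) = algebraMap (RatFunc K) L (RatFunc.C r) := by
    rw [← RatFunc.algebraMap_C, hφ, aeval_C, RatFunc.algebraMap_C, ← RatFunc.algebraMap_eq_C,
      ← IsScalarTower.algebraMap_apply]
  have hrange : (algebraMap (RatFunc K) L).range ≤ φ.range := by
    have hC (r : K) : algebraMap (RatFunc K) L (RatFunc.C r) ∈ φ.fieldRange := ⟨_, hφC r⟩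
    have hX : algebraMap (RatFunc K) L RatFunc.X ∈ φ.fieldRange := by
      have hamem : a ∈ φ.fieldRange := by
        rw [← inv_inv a]
        exact inv_mem ⟨_, hφX⟩
      have : algebraMap (RatFunc K) L RatFunc.X =
          a ^ n - a + algebraMap (RatFunc K) L (RatFunc.C θ) := by
        rw [ha, ← map_add, sub_add_cancel]
      rw [this]
      exact add_mem (sub_mem (pow_mem hamem n) hamem) (hC θ)
    have hpoly (f : K[X]) :
        algebraMap (RatFunc K) L (algebraMap K[X] (RatFunc K) f) ∈ φ.fieldRange := by
      induction f using Polynomial.induction_on' with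
      | add f g hf hg => rw [map_add, map_add]; exact add_mem hf hg
      | monomial i r =>
        rw [← C_mul_X_pow_eq_monomial, map_mul, map_mul, map_pow, map_pow, RatFunc.algebraMap_C,
          RatFunc.algebraMap_X]
        exact mul_mem (hC r) (pow_mem hX i)
    rintro _ ⟨x, rfl⟩
    obtain ⟨f, g, -, rfl⟩ := IsFractionRing.div_surjective (A := K[X]) x
    rw [map_div₀]
    change _ ∈ φ.fieldRange
    exact div_mem (hpoly f) (hpoly g)
  have hroot (y : L) (hy : y ^ n - y = algebraMap (RatFunc K) L (RatFunc.X - RatFunc.C θ))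
      (hya : y ≠ a) :
      (∑ i ∈ Finset.range n, X ^ i - C (RatFunc.X ^ (n - 1)) : (RatFunc K)[X]).eval₂ φ
        (y / a) = 0 := by
    rw [eval₂_sub, eval₂_C, map_pow, hφX, eval₂_finsetSum]
    simp only [eval₂_X_pow]
    rw [← ha] at hy
    have h1 : y / a - 1 ≠ 0 := by
      rw [sub_ne_zero, ne_eq, div_eq_one_iff_eq ha0]
      exact hya
    apply mul_right_cancel₀ h1
    rw [sub_mul, geom_sum_mul, zero_mul]
    obtain ⟨m, rfl⟩ : ∃ m, n = m + 1 := ⟨n - 1, by omega⟩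
    rw [Nat.add_sub_cancel, div_pow, inv_pow]
    field_simp
    linear_combination a ^ (m + 1) * hy
  obtain ⟨σ, hσ, hfix⟩ := exists_algEquiv_of_irreducible φ hrange
    (irreducible_geom_sum_sub_C_X_pow hn) (hroot b hb hba) (hroot d hd hda)
  have hσa : σ a = a := by
    have := hfix RatFunc.X
    rwa [hφX, map_inv₀, inv_inj] at this
  refine ⟨σ, hσa, ?_⟩
  rw [map_div₀, hσa] at hσ
  field_simp at hσ
  exact hσ

end RationalFunctionField

section GaloisGroup

universe u

variable {K : Type u} [Field K] {n : ℕ}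

theorem aeval_X_pow_sub_X_add_C_eq_zero_iff {L : Type*} [Field L] [Algebra (RatFunc K) L] {θ : K}
    {x : L} : aeval x (X ^ n - X + C (RatFunc.C θ - RatFunc.X) : (RatFunc K)[X]) = 0 ↔
      x ^ n - x = algebraMap (RatFunc K) L (RatFunc.X - RatFunc.C θ) := by
  rw [← sub_eq_zero (b := algebraMap _ _ _), map_add, map_sub, map_pow, aeval_X, aeval_C,
    ← neg_sub RatFunc.X, map_neg, ← sub_eq_add_neg]

theorem exists_ringHom_ratFunc_of_shift {k E : Type*} [Field k] [Algebra K k] [Field E]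
    [Algebra (PowerSeries k) E] [IsFractionRing (PowerSeries k) E] (r : k) :
    ∃ χ : RatFunc K →+* E,
      χ RatFunc.X = algebraMap (PowerSeries k) E (PowerSeries.X + PowerSeries.C r) ∧
      ∀ θ : K, χ (RatFunc.C θ) =
        algebraMap (PowerSeries k) E (PowerSeries.C (algebraMap K k θ)) := by
  let g : K[X] →+* E := (algebraMap (PowerSeries k) E).comp
    (coeToPowerSeries.ringHom.comp ((taylorAlgHom r : k[X] →+* k[X]).comp
      (mapRingHom (algebraMap K k))))
  have hg : Function.Injective g :=
    (FaithfulSMul.algebraMap_injective (PowerSeries k) E).comp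
      ((coe_injective k).comp ((taylor_injective r).comp
        (map_injective _ (algebraMap K k).injective)))
  refine ⟨IsFractionRing.lift hg, ?_, fun θ => ?_⟩
  · rw [← RatFunc.algebraMap_X, IsFractionRing.lift_algebraMap]
    simp [g]
  · rw [← RatFunc.algebraMap_C, IsFractionRing.lift_algebraMap]
    simp [g]

variable [CharZero K]

theorem galActionHom_two_transitive (hn : 2 ≤ n) (θ : K) {p : (RatFunc K)[X]}
    (hp : p = X ^ n - X + C (RatFunc.C θ - RatFunc.X)) (E : Type*) [Field E] [Algebra (RatFunc K) E]
    [Fact (p.map (algebraMap (RatFunc K) E)).Splits] (a b c d : p.rootSet E)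
    (hab : a ≠ b) (hcd : c ≠ d) :
    ∃ σ : p.Gal, Gal.galActionHom p E σ a = c ∧ Gal.galActionHom p E σ b = d := by
  have htrans := Gal.galAction_isPretransitive p E
    (hp ▸ irreducible_X_pow_sub_X_add_C_ratFunc hn θ)
  have hfix (u v w : p.rootSet E) (hv : v ≠ u) (hw : w ≠ u) :
      ∃ σ : p.Gal, σ • u = u ∧ σ • v = w := by
    let e := Gal.rootsEquivRoots p E
    have hroot (x : p.rootSet p.SplittingField) : (x : p.SplittingField) ^ n - x =
        algebraMap (RatFunc K) p.SplittingField (RatFunc.X - RatFunc.C θ) := by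
      rw [← aeval_X_pow_sub_X_add_C_eq_zero_iff, ← hp]
      exact (mem_rootSet.mp x.2).2
    have hne {x y : p.rootSet E} (h : x ≠ y) :
        (e.symm x : p.SplittingField) ≠ e.symm y :=
      fun h' => h (e.symm.injective (Subtype.ext h'))
    obtain ⟨(σ : p.Gal), hσu, hσv⟩ := exists_algEquiv_fixing_root hn
      (hroot (e.symm u)) (hroot (e.symm v))
      (hroot (e.symm w)) (hne hv) (hne hw)
    refine ⟨(σ : p.Gal), ?_, ?_⟩
    · rw [Gal.smul_def, ← Equiv.eq_symm_apply]
      exact Subtype.ext hσu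
    · rw [Gal.smul_def, ← Equiv.eq_symm_apply]
      exact Subtype.ext hσv
  obtain ⟨τ, hτ⟩ := htrans.exists_smul_eq a c
  obtain ⟨σ, hσc, hσb⟩ := hfix c (τ • b) d
    (fun h => hab (MulAction.injective τ (hτ.trans h.symm))) hcd.symm
  refine ⟨σ * τ, ?_, ?_⟩
  · change (σ * τ) • a = c
    rw [mul_smul, hτ, hσc]
  · change (σ * τ) • b = d
    rw [mul_smul, hσb]

theorem surjective_galActionHom_X_pow_sub_X_add_C (hn : 2 ≤ n) (θ : K) :
    ∃ (E : Type u) (_ : Field E) (_ : Algebra (RatFunc K) E)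
      (_ : Fact ((X ^ n - X + C (RatFunc.C θ - RatFunc.X) : (RatFunc K)[X]).map
        (algebraMap (RatFunc K) E)).Splits), Function.Surjective
      (Gal.galActionHom (X ^ n - X + C (RatFunc.C θ - RatFunc.X) : (RatFunc K)[X]) E) := by
  classical
  set p := (X ^ n - X + C (RatFunc.C θ - RatFunc.X) : (RatFunc K)[X]) with hp
  let k := AlgebraicClosure K
  have : CharZero k := charZero_of_injective_algebraMap (algebraMap K k).injective
  have hn0 : (n : k) ≠ 0 := Nat.cast_ne_zero.mpr (by omega)
  obtain ⟨c, hc⟩ := IsAlgClosed.exists_pow_nat_eq (n : k)⁻¹ (n := n - 1) (by omega)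
  have hc : (n : k) * c ^ (n - 1) = 1 := by rw [hc, mul_inv_cancel₀ hn0]
  let E₀ := FractionRing (PowerSeries k)
  obtain ⟨χ, hχX, hχC⟩ := exists_ringHom_ratFunc_of_shift (K := K) (E := E₀)
    (c ^ n - c + algebraMap K k θ)
  let : Algebra (RatFunc K) E₀ := χ.toAlgebra
  have hχ : algebraMap (RatFunc K) E₀ (RatFunc.X - RatFunc.C θ) =
      algebraMap (PowerSeries k) E₀ (PowerSeries.C (c ^ n - c) + PowerSeries.X) := by
    change χ _ = _
    rw [map_sub, hχX, hχC, ← map_sub, map_add PowerSeries.C]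
    congr 1
    ring
  have hmap : p.map (algebraMap (RatFunc K) E₀) = X ^ n - X - C (algebraMap (PowerSeries k) E₀
      (PowerSeries.C (c ^ n - c) + PowerSeries.X)) := by
    rw [← hχ, hp]
    simp only [Polynomial.map_add, Polynomial.map_sub, Polynomial.map_pow, map_X, map_C, map_sub]
    ring
  have hirr : Irreducible p := irreducible_X_pow_sub_X_add_C_ratFunc hn θ
  have hdeg : p.natDegree = n := by
    rw [← natDegree_map (algebraMap (RatFunc K) E₀), hmap, natDegree_X_pow_sub_X_sub_C hn]
  let E := (p.map (algebraMap (RatFunc K) E₀)).SplittingField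
  have hfact : Fact (p.map (algebraMap (RatFunc K) E)).Splits := by
    refine ⟨?_⟩
    rw [IsScalarTower.algebraMap_eq (RatFunc K) E₀ E, ← Polynomial.map_map]
    exact SplittingField.splits _
  refine ⟨E, inferInstance, inferInstance, hfact, ?_⟩
  obtain ⟨g, hg⟩ := Gal.exists_isSwap_of_card_roots (E₀ := E₀) p hirr.separable (by
    rw [hdeg]
    convert le_ncard_pow_sub_self_eq (E := E₀) hn hc using 3
    ext x
    rw [mem_rootSet, and_iff_right hirr.ne_zero, Set.mem_ofPred_eq, ← hχ]
    exact aeval_X_pow_sub_X_add_C_eq_zero_iff) (by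
    rw [hmap]
    exact not_splits_map_X_pow_sub_X_sub_C hn hc) E
  exact MonoidHom.surjective_of_isSwap_of_two_transitive _ hg
    (galActionHom_two_transitive hn θ hp E)

end GaloisGroup

/-- For a field `K` of characteristic zero, `t ≥ 4` and `θ ∈ K`, the Galois group of
the polynomial `x^{t-1} - x + θ - T` over the rational function field `K(T)` is the
full symmetric group on `t - 1` letters. -/
theorem galois_group_symmetric (K : Type) [Field K] [CharZero K]
    (t : ℕ) (ht : 4 ≤ t) (θ : K) :
    Nonempty ((X ^ (t - 1) - X + C (RatFunc.C θ - RatFunc.X) : (RatFunc K)[X]).Gal ≃*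
      Equiv.Perm (Fin (t - 1))) := by
  have hn : 2 ≤ t - 1 := by omega
  obtain ⟨E, _, _, _, hsurj⟩ := surjective_galActionHom_X_pow_sub_X_add_C hn θ
  set p := (X ^ (t - 1) - X + C (RatFunc.C θ - RatFunc.X) : (RatFunc K)[X]) with hp
  have hdeg : p.natDegree = t - 1 := by
    rw [hp, ← neg_sub RatFunc.X, C_neg, ← sub_eq_add_neg, natDegree_X_pow_sub_X_sub_C hn]
  have hcard : Fintype.card (p.rootSet E) = t - 1 := by
    rw [card_rootSet_eq_natDegree (irreducible_X_pow_sub_X_add_C_ratFunc hn θ).separable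
      Fact.out, hdeg]
  exact ⟨(MulEquiv.ofBijective (Gal.galActionHom p E)
    ⟨Gal.galActionHom_injective p E, hsurj⟩).trans
      (Equiv.permCongrHom (Fintype.equivFinOfCardEq hcard))⟩
end
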